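/- (Canonical form for congruence; Horn–Sergeichuk, stated as Theorem 2.1(a) of the paper.) Every matrix A ∈ ℂ^{n×n} is congruent to a block-diagonal direct sum of canonical blocks, each of one of the three types: J_k(0) (Type 0), Γ_k (Type I), or H_{2k}(μ) with μ ∈ ℂ satisfying 0 ≠ μ ≠ (−1)^{k+1} (Type II); moreover this direct sum is uniquely determined up to permutation of the summands and up to replacing the parameter μ of any block H_{2k}(μ) by μ^{−1}. -/

import Mathlib

open Matrix

noncomputable section

/-- The `k × k` Jordan block `J_k(μ)` (eigenvalue `μ` on the diagonal, `1` on the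
superdiagonal). -/
def Jblock (k : ℕ) (μ : ℂ) : Matrix (Fin k) (Fin k) ℂ :=
  Matrix.of fun i j =>
    if (j : ℕ) = (i : ℕ) then μ else if (j : ℕ) = (i : ℕ) + 1 then 1 else 0

/-- The `k × k` matrix `Γ_k`: in 1-based indexing, the `(i,j)` entry is `(-1)^(k-i)`
when `j = k+1-i` or `j = k+2-i`, and `0` otherwise. -/
def Gamma (k : ℕ) : Matrix (Fin k) (Fin k) ℂ :=
  Matrix.of fun i j =>
    if (i : ℕ) + (j : ℕ) = k - 1 ∨ (i : ℕ) + (j : ℕ) = k then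
      (-1 : ℂ) ^ (k - 1 - (i : ℕ)) else 0

/-- Block-diagonal direct sum of two square complex matrices. -/
def dsum {m n : ℕ} (A : Matrix (Fin m) (Fin m) ℂ) (B : Matrix (Fin n) (Fin n) ℂ) :
    Matrix (Fin (m + n)) (Fin (m + n)) ℂ :=
  Matrix.reindex finSumFinEquiv finSumFinEquiv (Matrix.fromBlocks A 0 0 B)

/-- The `2k × 2k` matrix `H_{2k}(μ) = [[0, I_k], [J_k(μ), 0]]`. -/
def Hblock (k : ℕ) (μ : ℂ) : Matrix (Fin (k + k)) (Fin (k + k)) ℂ :=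
  Matrix.reindex finSumFinEquiv finSumFinEquiv (Matrix.fromBlocks 0 1 (Jblock k μ) 0)

/-- Descriptors of the canonical blocks for congruence (Horn–Sergeichuk):
Type 0 blocks `J_k(0)`, Type I blocks `Γ_k`, and Type II blocks `H_{2k}(μ)`. -/
inductive CBlock : Type
  | type0 (k : ℕ)
  | typeI (k : ℕ)
  | typeII (k : ℕ) (μ : ℂ)

/-- The size of the matrix described by a block descriptor. -/
def CBlock.size : CBlock → ℕ
  | .type0 k => k
  | .typeI k => k
  | .typeII k _ => k + k

/-- The matrix described by a block descriptor. -/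
def CBlock.mat : (b : CBlock) → Matrix (Fin b.size) (Fin b.size) ℂ
  | .type0 k => Jblock k 0
  | .typeI k => Gamma k
  | .typeII k μ => Hblock k μ

/-- Validity of a block descriptor: sizes are at least `1`, and a Type II block
`H_{2k}(μ)` must satisfy `0 ≠ μ ≠ (-1)^(k+1)`. -/
def CBlock.Valid : CBlock → Prop
  | .type0 k => 1 ≤ k
  | .typeI k => 1 ≤ k
  | .typeII k μ => 1 ≤ k ∧ μ ≠ 0 ∧ μ ≠ (-1) ^ (k + 1)

/-- Two block descriptors are equivalent when they are equal, or when both are Type II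
blocks of the same size whose parameters are obtained from one another by `μ ↦ μ⁻¹`. -/
def CBlock.Equiv (b b' : CBlock) : Prop :=
  b = b' ∨ ∃ (k : ℕ) (μ : ℂ), b = CBlock.typeII k μ ∧ b' = CBlock.typeII k μ⁻¹

/-- Total size of a list of block descriptors. -/
def blocksSize : List CBlock → ℕ
  | [] => 0
  | b :: L => b.size + blocksSize L

/-- Block-diagonal direct sum of a list of block descriptors. -/
def blocksMat : (L : List CBlock) → Matrix (Fin (blocksSize L)) (Fin (blocksSize L)) ℂ
  | [] => 0
  | b :: L => dsum b.mat (blocksMat L)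

section part1

open Polynomial in
/-- Polynomial square roots modulo a polynomial with nonzero roots. -/
theorem exists_poly_sqrt (m : ℂ[X]) (hm : m.Monic) (h0 : m.eval 0 ≠ 0) :
    ∃ G : ℂ[X], m ∣ G * G - X := by
  classical
  let s := m.roots.toFinset
  let q : ℂ[X] := Lagrange.interpolate s id (fun r => r ^ (1 / 2 : ℂ))
  have hq : ∀ r ∈ m.roots, q.eval r * q.eval r = r := by
    intro r hr
    have := Lagrange.eval_interpolate_at_node (v := id) (s := s) (i := r)
      (r := fun r : ℂ => r ^ (1 / 2 : ℂ)) (Function.injective_id.injOn) (by simpa [s] using hr)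
    have h1 : q.eval r = r ^ (1 / 2 : ℂ) := this
    rw [h1]
    by_cases hr0 : r = 0
    · subst hr0; simp
    · rw [← Complex.cpow_add _ _ hr0]; norm_num
  have hne : m ≠ 0 := hm.ne_zero
  have hr0 : ∀ r ∈ m.roots, r ≠ 0 := by
    rintro r hr rfl
    exact h0 ((mem_roots hne).1 hr)
  let w : ℂ[X] := q * q - X
  have hsp : m.Splits := IsAlgClosed.splits m
  have hdvd : m ∣ w ^ (Multiset.card m.roots) := by
    have h := hsp.eq_prod_roots_of_monic hm
    have : (m.roots.map (fun a => X - C a)).prod ∣ (m.roots.map (fun _ => w)).prod := by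
      apply Multiset.prod_dvd_prod_of_dvd
      intro a ha
      rw [dvd_iff_isRoot]
      simp [w, hq a ha]
    rw [← h] at this
    simpa using this
  have hcop : IsCoprime q m := by
    refine isCoprime_of_irreducible_dvd (fun h => hne h.2) ?_
    intro z hz hzq hzm
    have hd := IsAlgClosed.degree_eq_one_of_irreducible ℂ hz
    obtain ⟨r, hr⟩ := IsAlgClosed.exists_root z (by rw [hd]; exact one_ne_zero)
    have h1 : r ∈ m.roots := (mem_roots hne).2 (hr.dvd hzm)
    have h2 : q.eval r = 0 := hr.dvd hzq
    have h3 := hq r h1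
    rw [h2] at h3
    exact hr0 r h1 (by simpa using h3.symm)
  let mk : ℂ[X] →ₐ[ℂ] (AdjoinRoot m) := AdjoinRoot.mkₐ m
  have hmk : ∀ p, mk p = AdjoinRoot.mk m p := fun p => rfl
  have hqu : IsUnit (mk q) := by
    obtain ⟨a, b, hab⟩ := hcop
    have : mk a * mk q = 1 := by
      have h := congrArg mk hab
      simp only [map_add, map_mul, map_one] at h
      have h2 : mk m = 0 := by rw [hmk, AdjoinRoot.mk_self]
      rw [h2, mul_zero, add_zero] at h
      exact h
    exact IsUnit.of_mul_eq_one _ (by rw [mul_comm]; exact this)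
  let P : (AdjoinRoot m)[X] := X ^ 2 - C (mk X)
  have hP : ∀ x, aeval x P = x ^ 2 - mk X := by intro x; simp [P]
  have hnil : IsNilpotent (aeval (mk q) P) := by
    refine ⟨Multiset.card m.roots, ?_⟩
    rw [hP]
    have : mk q ^ 2 - mk X = mk w := by simp [w, pow_two]
    rw [this, ← map_pow, hmk, AdjoinRoot.mk_eq_zero]
    exact hdvd
  have hun : IsUnit (aeval (mk q) (derivative P)) := by
    have : aeval (mk q) (derivative P) = algebraMap ℂ _ 2 * mk q := by
      rw [show (algebraMap ℂ (AdjoinRoot m)) 2 = 2 from map_ofNat _ 2]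
      simp [P]; ring
    rw [this]
    exact (IsUnit.map _ (IsUnit.mk0 _ (by norm_num))).mul hqu
  obtain ⟨r, ⟨-, hr⟩, -⟩ := existsUnique_nilpotent_sub_and_aeval_eq_zero hnil hun
  obtain ⟨G, rfl⟩ := AdjoinRoot.mk_surjective r
  refine ⟨G, ?_⟩
  rw [← AdjoinRoot.mk_eq_zero]
  rw [hP] at hr
  simpa [pow_two, hmk] using hr

open Polynomial in
theorem exists_mat_sqrt {κ : Type*} [Fintype κ] [DecidableEq κ] (Q : Matrix κ κ ℂ)
    (hQ : IsUnit Q) : ∃ G : ℂ[X], aeval Q G * aeval Q G = Q := by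
  obtain ⟨G, hG⟩ := exists_poly_sqrt Q.charpoly (Matrix.charpoly_monic Q) (by
    intro h
    have h1 := Matrix.det_eq_sign_charpoly_coeff Q
    rw [Polynomial.coeff_zero_eq_eval_zero, h, mul_zero] at h1
    have := (Matrix.isUnit_iff_isUnit_det Q).1 hQ
    rw [h1] at this
    simp at this)
  refine ⟨G, ?_⟩
  obtain ⟨c, hc⟩ := hG
  have h := congrArg (aeval Q) hc
  rw [map_mul, Matrix.aeval_self_charpoly, zero_mul, map_sub, map_mul, aeval_X, sub_eq_zero] at h
  exact h

variable {ι κ τ : Type*} [Fintype ι] [Fintype κ] [Fintype τ] [DecidableEq ι] [DecidableEq κ]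
  [DecidableEq τ]

/-- Congruence of matrices with possibly different index types. -/
def Cong (A : Matrix ι ι ℂ) (B : Matrix κ κ ℂ) : Prop :=
  ∃ (P : Matrix ι κ ℂ) (P' : Matrix κ ι ℂ), P * P' = 1 ∧ P' * P = 1 ∧ A = P * B * Pᵀ

/-- Strict equivalence of matrix pencils. -/
def SE (A₀ A₁ : Matrix ι ι ℂ) (B₀ B₁ : Matrix κ κ ℂ) : Prop :=
  ∃ (R : Matrix ι κ ℂ) (R' : Matrix κ ι ℂ) (S : Matrix κ ι ℂ) (S' : Matrix ι κ ℂ),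
    R * R' = 1 ∧ R' * R = 1 ∧ S * S' = 1 ∧ S' * S = 1 ∧ A₀ = R * B₀ * S ∧ A₁ = R * B₁ * S

theorem Cong.trans' {A : Matrix ι ι ℂ} {B : Matrix κ κ ℂ}
    {D : Matrix τ τ ℂ}
    (h₁ : Cong A B) (h₂ : Cong B D) : Cong A D := by
  obtain ⟨P, P', h1, h2, h3⟩ := h₁
  obtain ⟨Q, Q', k1, k2, k3⟩ := h₂
  refine ⟨P * Q, Q' * P', ?_, ?_, ?_⟩
  · rw [Matrix.mul_assoc, ← Matrix.mul_assoc Q, k1, Matrix.one_mul, h1]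
  · rw [Matrix.mul_assoc, ← Matrix.mul_assoc P', h2, Matrix.one_mul, k2]
  · rw [h3, k3, Matrix.transpose_mul]; simp only [Matrix.mul_assoc]

theorem Cong.symm' {A : Matrix ι ι ℂ} {B : Matrix κ κ ℂ} (h : Cong A B) : Cong B A := by
  obtain ⟨P, P', h1, h2, h3⟩ := h
  refine ⟨P', P, h2, h1, ?_⟩
  have h4 : Pᵀ * P'ᵀ = 1 := by rw [← Matrix.transpose_mul, h2, Matrix.transpose_one]
  rw [h3, Matrix.mul_assoc P', Matrix.mul_assoc (P * B), h4, Matrix.mul_one, ← Matrix.mul_assoc, h2,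
    Matrix.one_mul]

theorem Cong.se {A : Matrix ι ι ℂ} {B : Matrix κ κ ℂ} (h : Cong A B) : SE A Aᵀ B Bᵀ := by
  obtain ⟨P, P', h1, h2, h3⟩ := h
  refine ⟨P, P', Pᵀ, P'ᵀ, h1, h2, ?_, ?_, h3, ?_⟩
  · rw [← Matrix.transpose_mul, h2, Matrix.transpose_one]
  · rw [← Matrix.transpose_mul, h1, Matrix.transpose_one]
  · rw [h3]; simp [Matrix.transpose_mul, Matrix.mul_assoc]

theorem SE.trans' {A₀ A₁ : Matrix ι ι ℂ} {B₀ B₁ : Matrix κ κ ℂ} {D₀ D₁ : Matrix τ τ ℂ}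
    (h₁ : SE A₀ A₁ B₀ B₁) (h₂ : SE B₀ B₁ D₀ D₁) : SE A₀ A₁ D₀ D₁ := by
  obtain ⟨R, R', S, S', h1, h2, h3, h4, h5, h6⟩ := h₁
  obtain ⟨Q, Q', T, T', k1, k2, k3, k4, k5, k6⟩ := h₂
  refine ⟨R * Q, Q' * R', T * S, S' * T', ?_, ?_, ?_, ?_, ?_, ?_⟩
  · rw [Matrix.mul_assoc, ← Matrix.mul_assoc Q, k1, Matrix.one_mul, h1]
  · rw [Matrix.mul_assoc, ← Matrix.mul_assoc R', h2, Matrix.one_mul, k2]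
  · rw [Matrix.mul_assoc, ← Matrix.mul_assoc S, h3, Matrix.one_mul, k3]
  · rw [Matrix.mul_assoc, ← Matrix.mul_assoc T', k4, Matrix.one_mul, h4]
  · rw [h5, k5]; simp only [Matrix.mul_assoc]
  · rw [h6, k6]; simp only [Matrix.mul_assoc]

theorem SE.symm' {A₀ A₁ : Matrix ι ι ℂ} {B₀ B₁ : Matrix κ κ ℂ}
    (h : SE A₀ A₁ B₀ B₁) : SE B₀ B₁ A₀ A₁ := by
  obtain ⟨R, R', S, S', h1, h2, h3, h4, h5, h6⟩ := h
  have key : ∀ B : Matrix κ κ ℂ, B = R' * (R * B * S) * S' := by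
    intro B
    rw [Matrix.mul_assoc, Matrix.mul_assoc (R * B), h3, Matrix.mul_one, ← Matrix.mul_assoc, h2,
      Matrix.one_mul]
  exact ⟨R', R, S', S, h2, h1, h4, h3, by rw [h5]; exact key _, by rw [h6]; exact key _⟩

theorem aeval_intertwine {Q B : Matrix κ κ ℂ} (h : Q * B = B * Qᵀ) (G : Polynomial ℂ) :
    Polynomial.aeval Q G * B = B * (Polynomial.aeval Q G)ᵀ := by
  induction G using Polynomial.induction_on' with
  | add p q hp hq => simp [Matrix.add_mul, Matrix.mul_add, hp, hq]
  | monomial n a =>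
    have : ∀ n : ℕ, Q ^ n * B = B * (Q ^ n)ᵀ := by
      intro n
      induction n with
      | zero => simp
      | succ n ih =>
        rw [pow_succ, Matrix.mul_assoc, h, ← Matrix.mul_assoc, ih, Matrix.mul_assoc,
          ← Matrix.transpose_mul, ← pow_succ', ← pow_succ]
    simp only [Polynomial.aeval_monomial, Algebra.algebraMap_eq_smul_one, smul_mul_assoc, one_mul,
      Matrix.transpose_smul, mul_smul_comm]
    rw [this]

/-- The root trick: strictly equivalent pencils `(A, Aᵀ)`, `(B, Bᵀ)` come from congruent matrices. -/
theorem cong_of_se {A : Matrix ι ι ℂ} {B : Matrix κ κ ℂ} (h : SE A Aᵀ B Bᵀ) : Cong A B := by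
  obtain ⟨R, R', S, S', h1, h2, h3, h4, h5, h6⟩ := h
  have hA : A = Sᵀ * B * Rᵀ := by
    have := congrArg Matrix.transpose h6
    simpa [Matrix.transpose_mul, Matrix.mul_assoc] using this
  have hSS : Sᵀ * S'ᵀ = 1 := by rw [← Matrix.transpose_mul, h4, Matrix.transpose_one]
  have hSS' : S'ᵀ * Sᵀ = 1 := by rw [← Matrix.transpose_mul, h3, Matrix.transpose_one]
  set Q : Matrix κ κ ℂ := S'ᵀ * R with hQ
  have hQZ : Q * (R' * Sᵀ) = 1 := by
    rw [hQ, Matrix.mul_assoc, ← Matrix.mul_assoc R, h1, Matrix.one_mul, hSS']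
  have hQu : IsUnit Q := IsUnit.of_mul_eq_one _ hQZ
  have hQB : Q * B = B * Qᵀ := by
    have h7 : S'ᵀ * (R * B * S) * S' = S'ᵀ * (Sᵀ * B * Rᵀ) * S' := by rw [← h5, ← hA]
    have h8 : S'ᵀ * (R * B * S) * S' = Q * B := by
      rw [hQ, Matrix.mul_assoc, Matrix.mul_assoc (R * B), h3, Matrix.mul_one, Matrix.mul_assoc]
    have h9 : S'ᵀ * (Sᵀ * B * Rᵀ) * S' = B * Qᵀ := by
      rw [hQ, Matrix.transpose_mul, Matrix.transpose_transpose, Matrix.mul_assoc Sᵀ,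
        ← Matrix.mul_assoc S'ᵀ, hSS', Matrix.one_mul, Matrix.mul_assoc]
    rw [← h8, h7, h9]
  obtain ⟨G, hG⟩ := exists_mat_sqrt Q hQu
  set g := Polynomial.aeval Q G with hg
  have hgB : g * B = B * gᵀ := aeval_intertwine hQB G
  have hgu : g * (g * (R' * Sᵀ)) = 1 := by rw [← Matrix.mul_assoc, hG, hQZ]
  have hgu' : (g * (R' * Sᵀ)) * g = 1 := mul_eq_one_comm.1 hgu
  refine ⟨Sᵀ * g, (g * (R' * Sᵀ)) * S'ᵀ, ?_, ?_, ?_⟩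
  · rw [Matrix.mul_assoc, ← Matrix.mul_assoc g, hgu, Matrix.one_mul, hSS]
  · rw [Matrix.mul_assoc, ← Matrix.mul_assoc S'ᵀ, hSS', Matrix.one_mul, hgu']
  · rw [Matrix.transpose_mul, Matrix.transpose_transpose, Matrix.mul_assoc Sᵀ, hgB,
      Matrix.mul_assoc, Matrix.mul_assoc, ← Matrix.mul_assoc gᵀ, ← Matrix.transpose_mul, hG,
      ← Matrix.mul_assoc B, ← hQB, hQ, ← Matrix.mul_assoc, ← Matrix.mul_assoc, ← Matrix.mul_assoc,
      hSS, Matrix.one_mul]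
    exact h5

theorem cong_reindex (e : ι ≃ κ) (A : Matrix ι ι ℂ) : Cong A (Matrix.reindex e e A) := by
  refine ⟨(1 : Matrix κ κ ℂ).submatrix e id, (1 : Matrix κ κ ℂ).submatrix id e, ?_, ?_, ?_⟩
  · ext i j; simp [Matrix.mul_apply, Matrix.one_apply]
  · ext i j
    simp [Matrix.mul_apply, Matrix.one_apply]
    rw [Finset.sum_eq_single (e.symm i)]
    · simp
    · intro b _ hb
      have : i ≠ e b := by rintro rfl; simp at hb
      simp [this]
    · simp
  · ext i j
    simp [Matrix.mul_apply, Matrix.one_apply]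

theorem cong_fromBlocks {ι' κ' : Type*} [Fintype ι'] [Fintype κ'] [DecidableEq ι'] [DecidableEq κ']
    {A : Matrix ι ι ℂ} {B : Matrix κ κ ℂ} {A' : Matrix ι' ι' ℂ} {B' : Matrix κ' κ' ℂ}
    (h : Cong A B) (h' : Cong A' B') :
    Cong (Matrix.fromBlocks A 0 0 A') (Matrix.fromBlocks B 0 0 B') := by
  obtain ⟨P, P', h1, h2, h3⟩ := h
  obtain ⟨Q, Q', k1, k2, k3⟩ := h'
  refine ⟨Matrix.fromBlocks P 0 0 Q, Matrix.fromBlocks P' 0 0 Q', ?_, ?_, ?_⟩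
  · simp [Matrix.fromBlocks_multiply, h1, k1]
  · simp [Matrix.fromBlocks_multiply, h2, k2]
  · simp [Matrix.fromBlocks_multiply, Matrix.fromBlocks_transpose, ← h3, ← k3]

/-- A triangularity criterion for invertibility. -/
theorem isUnit_of_level (G : Matrix ι ι ℂ) (σ : ι → ι) (ℓ : ι → ℕ)
    (h0 : ∀ i, G (σ i) i ≠ 0) (h1 : ∀ i j, j ≠ i → ℓ i ≤ ℓ j → G (σ i) j = 0) : IsUnit G := by
  rw [← Matrix.mulVec_injective_iff_isUnit]
  refine (injective_iff_map_eq_zero (Matrix.mulVecLin G)).2 ?_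
  intro c hc
  have hc' : ∀ i, ∑ j, G i j * c j = 0 := by
    intro i
    have := congrFun hc i
    simpa [Matrix.mulVec, dotProduct] using this
  have key : ∀ n i, ℓ i = n → c i = 0 := by
    intro n
    induction n using Nat.strong_induction_on with
    | _ n ih =>
      intro i hi
      have h := hc' (σ i)
      rw [Finset.sum_eq_single i] at h
      · exact (mul_eq_zero.1 h).resolve_left (h0 i)
      · intro j _ hj
        by_cases hl : ℓ i ≤ ℓ j
        · rw [h1 i j hj hl, zero_mul]
        · rw [ih (ℓ j) (by omega) j rfl, mul_zero]
      · simp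
  funext i
  exact key _ i rfl

end part1

section part2

variable {ι κ τ : Type*} [Fintype ι] [Fintype κ] [Fintype τ] [DecidableEq ι] [DecidableEq κ]
  [DecidableEq τ]

theorem Cong.card_eq {A : Matrix ι ι ℂ} {B : Matrix κ κ ℂ} (h : Cong A B) :
    Fintype.card ι = Fintype.card κ := by
  obtain ⟨P, P', h1, h2, -⟩ := h
  exact Matrix.square_of_invertible P P' h1 h2

theorem mul_eq_zero_of_mulVec {d : ℕ} {θ : Type*} (E' : Matrix ι (Fin d) ℂ)
    (hinj : ∀ c : Fin d → ℂ, E' *ᵥ c = 0 → c = 0) (M : Matrix (Fin d) θ ℂ) (hM : E' * M = 0) :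
    M = 0 := by
  ext i j
  have := hinj (fun i => M i j) (by
    ext k
    have := congrFun (congrFun hM k) j
    simpa [Matrix.mul_apply, Matrix.mulVec, dotProduct] using this)
  exact congrFun this i

/-- Completing the columns of `E` by a basis of the kernel of `Φ`. -/
theorem exists_complement (E : Matrix ι κ ℂ) (Φ : Matrix κ ι ℂ) (h : IsUnit (Φ * E)) :
    ∃ (d : ℕ) (E' : Matrix ι (Fin d) ℂ) (X : Matrix κ ι ℂ) (Y : Matrix (Fin d) ι ℂ),
      Φ * E' = 0 ∧ X * E = 1 ∧ X * E' = 0 ∧ Y * E = 0 ∧ Y * E' = 1 ∧ E * X + E' * Y = 1 := by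
  obtain ⟨Z, hZ1, hZ2⟩ : ∃ Z : Matrix κ κ ℂ, Z * (Φ * E) = 1 ∧ (Φ * E) * Z = 1 := by
    obtain ⟨u, hu⟩ := h
    exact ⟨↑u⁻¹, by rw [← hu]; exact u.inv_mul, by rw [← hu]; exact u.mul_inv⟩
  let K := LinearMap.ker Φ.mulVecLin
  let d := Module.finrank ℂ K
  let b : Module.Basis (Fin d) ℂ K := Module.finBasis ℂ K
  let E' : Matrix ι (Fin d) ℂ := Matrix.of fun i j => (b j : ι → ℂ) i
  have hE'v : ∀ c : Fin d → ℂ, E' *ᵥ c = ((∑ j, c j • b j : K) : ι → ℂ) := by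
    intro c
    ext i
    simp [E', Matrix.mulVec, dotProduct, mul_comm]
  have hinj : ∀ c : Fin d → ℂ, E' *ᵥ c = 0 → c = 0 := by
    intro c hc
    rw [hE'v] at hc
    have h2 : (∑ j, c j • b j : K) = 0 := Subtype.ext hc
    have := Fintype.linearIndependent_iff.1 b.linearIndependent c h2
    exact funext this
  have hΦE' : Φ * E' = 0 := by
    ext i j
    have : Φ *ᵥ (b j : ι → ℂ) = 0 := (b j).2
    have := congrFun this i
    simpa [Matrix.mul_apply, Matrix.mulVec, dotProduct, E'] using this
  let X := Z * Φ
  have hXE : X * E = 1 := by simp only [X]; rw [Matrix.mul_assoc, hZ1]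
  have hXE' : X * E' = 0 := by simp only [X]; rw [Matrix.mul_assoc, hΦE', Matrix.mul_zero]
  have hk : Φ * (1 - E * X) = 0 := by
    simp only [X]
    rw [Matrix.mul_sub, Matrix.mul_one, ← Matrix.mul_assoc, ← Matrix.mul_assoc, hZ2,
      Matrix.one_mul, sub_self]
  have hmem : ∀ j : ι, (fun i => ((1 : Matrix ι ι ℂ) - E * X) i j) ∈ K := by
    intro j
    rw [LinearMap.mem_ker, Matrix.mulVecLin_apply]
    ext i
    have := congrFun (congrFun hk i) j
    simpa [Matrix.mul_apply, Matrix.mulVec, dotProduct] using this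
  let Y : Matrix (Fin d) ι ℂ := Matrix.of fun i j => b.repr ⟨_, hmem j⟩ i
  have hY : E' * Y = 1 - E * X := by
    ext i j
    have h1 := hE'v (fun l => Y l j)
    have h2 : (∑ l, Y l j • b l : K) = ⟨_, hmem j⟩ := b.sum_repr ⟨_, hmem j⟩
    rw [h2] at h1
    have := congrFun h1 i
    simpa [Matrix.mul_apply, Matrix.mulVec, dotProduct] using this
  refine ⟨d, E', X, Y, hΦE', hXE, hXE', ?_, ?_, by rw [hY]; abel⟩
  · apply mul_eq_zero_of_mulVec E' hinj
    rw [← Matrix.mul_assoc, hY, Matrix.sub_mul, Matrix.mul_assoc, hXE]; simp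
  · have : E' * (Y * E' - 1) = 0 := by
      rw [Matrix.mul_sub, ← Matrix.mul_assoc, hY, Matrix.sub_mul, Matrix.mul_assoc, hXE']; simp
    exact sub_eq_zero.1 (mul_eq_zero_of_mulVec E' hinj _ this)

/-- The splitting lemma. -/
theorem split_lemma (A : Matrix ι ι ℂ) (K : Matrix τ τ ℂ) (K₀ K₁ : Matrix κ κ ℂ)
    (hK : SE K Kᵀ K₀ K₁)
    (E : Matrix ι κ ℂ) (Φ : Matrix κ ι ℂ) (h₀ : A * E = Φᵀ * K₀) (h₁ : Aᵀ * E = Φᵀ * K₁)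
    (h : IsUnit (Φ * E)) :
    ∃ (d : ℕ) (A' : Matrix (Fin d) (Fin d) ℂ), Cong A (Matrix.fromBlocks K 0 0 A') := by
  obtain ⟨d, E', X, Y, hΦE', hXE, hXE', hYE, hYE', hsum⟩ := exists_complement E Φ h
  refine ⟨d, E'ᵀ * A * E', ?_⟩
  have hz : (Φ * E')ᵀ = 0 := by rw [hΦE', Matrix.transpose_zero]
  rw [Matrix.transpose_mul] at hz
  have e1 : E'ᵀ * A * E = 0 := by
    rw [Matrix.mul_assoc, h₀, ← Matrix.mul_assoc, hz, Matrix.zero_mul]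
  have e2 : Eᵀ * A * E' = 0 := by
    have : (E'ᵀ * Aᵀ * E)ᵀ = 0 := by
      rw [Matrix.mul_assoc, h₁, ← Matrix.mul_assoc, hz, Matrix.zero_mul, Matrix.transpose_zero]
    simpa [Matrix.transpose_mul, Matrix.mul_assoc] using this
  have c1 : Cong (Matrix.fromBlocks (Eᵀ * A * E) 0 0 (E'ᵀ * A * E')) A := by
    refine ⟨(Matrix.fromCols E E')ᵀ, (Matrix.fromRows X Y)ᵀ, ?_, ?_, ?_⟩
    · rw [← Matrix.transpose_mul, Matrix.fromRows_mul_fromCols, hXE, hXE', hYE, hYE',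
        Matrix.fromBlocks_one, Matrix.transpose_one]
    · rw [← Matrix.transpose_mul, Matrix.fromCols_mul_fromRows, hsum, Matrix.transpose_one]
    · rw [Matrix.transpose_transpose, Matrix.transpose_fromCols, Matrix.fromRows_mul,
        Matrix.fromRows_mul_fromCols, e1, e2]
  refine c1.symm'.trans' (cong_fromBlocks (cong_of_se ?_) ?_)
  · refine SE.trans' (B₀ := K₀) (B₁ := K₁) ?_ hK.symm'
    obtain ⟨u, hu⟩ := h
    refine ⟨(Φ * E)ᵀ, (↑u⁻¹ : Matrix κ κ ℂ)ᵀ, 1, 1, ?_, ?_, Matrix.one_mul 1, Matrix.one_mul 1,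
      ?_, ?_⟩
    · rw [← Matrix.transpose_mul, ← hu]; rw [u.inv_mul, Matrix.transpose_one]
    · rw [← Matrix.transpose_mul, ← hu]; rw [u.mul_inv, Matrix.transpose_one]
    · rw [Matrix.mul_one, Matrix.mul_assoc, h₀, Matrix.transpose_mul, Matrix.mul_assoc]
    · rw [Matrix.mul_one, Matrix.transpose_mul, Matrix.transpose_mul, Matrix.transpose_transpose,
        h₁, Matrix.transpose_mul, Matrix.mul_assoc]
  · exact ⟨1, 1, Matrix.one_mul 1, Matrix.one_mul 1, by simp⟩

end part2

section part3

theorem mul_Jblock_apply {ι : Type*} {k : ℕ} (M : Matrix ι (Fin k) ℂ) (μ : ℂ) (i : ι) (j : Fin k) :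
    (M * Jblock k μ) i j = μ * M i j +
      (if h : 0 < (j : ℕ) then M i ⟨j - 1, by omega⟩ else 0) := by
  have hs : ∀ l : Fin k, M i l * Jblock k μ l j =
      (if l = j then M i l * μ else 0) + (if (j : ℕ) = l + 1 then M i l else 0) := by
    intro l
    simp only [Jblock, Matrix.of_apply]
    by_cases h1 : (j : ℕ) = l
    · have : l = j := Fin.ext h1.symm
      subst this; simp
    · have h2 : l ≠ j := fun h => h1 (by rw [h])
      simp [h1, h2]
  rw [Matrix.mul_apply, Finset.sum_congr rfl (fun l _ => hs l), Finset.sum_add_distrib]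
  congr 1
  · simp [mul_comm]
  · split_ifs with h
    · rw [Finset.sum_eq_single ⟨j - 1, by omega⟩]
      · rw [if_pos]; simp; omega
      · intro b _ hb
        rw [if_neg]
        intro hjb
        apply hb
        ext; simp; omega
      · simp
    · apply Finset.sum_eq_zero
      intro b _
      rw [if_neg]; omega

/-- The matrix of a Jordan chain. -/
def chainM {ι : Type*} [Fintype ι] [DecidableEq ι] (C : Matrix ι ι ℂ) (μ : ℂ) (k : ℕ) (x : ι → ℂ) :
    Matrix ι (Fin k) ℂ :=
  Matrix.of fun i j => (((C - μ • (1 : Matrix ι ι ℂ)) ^ (k - 1 - (j : ℕ))) *ᵥ x) i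

theorem mul_chainM {ι : Type*} [Fintype ι] [DecidableEq ι] (C : Matrix ι ι ℂ) (μ : ℂ) (k : ℕ)
    (x : ι → ℂ) (h : ((C - μ • (1 : Matrix ι ι ℂ)) ^ k) *ᵥ x = 0) :
    C * chainM C μ k x = chainM C μ k x * Jblock k μ := by
  ext i j
  rw [mul_Jblock_apply]
  set N := C - μ • (1 : Matrix ι ι ℂ) with hN
  have hC : C = N + μ • (1 : Matrix ι ι ℂ) := by rw [hN]; abel
  have h1 : (C * chainM C μ k x) i j = (C *ᵥ ((N ^ (k - 1 - (j : ℕ))) *ᵥ x)) i := by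
    simp [Matrix.mul_apply, Matrix.mulVec, dotProduct, chainM, ← hN]
  rw [h1]
  have h2 : C *ᵥ ((N ^ (k - 1 - (j : ℕ))) *ᵥ x) =
      (N ^ (k - 1 - (j : ℕ) + 1)) *ᵥ x + μ • ((N ^ (k - 1 - (j : ℕ))) *ᵥ x) := by
    rw [pow_succ', ← Matrix.mulVec_mulVec, hC, Matrix.add_mulVec, Matrix.smul_mulVec,
      Matrix.one_mulVec]
  rw [h2]
  split_ifs with hj
  · simp only [Pi.add_apply, Pi.smul_apply, smul_eq_mul, chainM, Matrix.of_apply, ← hN]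
    rw [add_comm, show k - 1 - (j : ℕ) + 1 = k - 1 - ((j : ℕ) - 1) by omega]
  · rw [show k - 1 - (j : ℕ) + 1 = k by omega, h]
    simp [chainM, ← hN]

theorem jordan_lemma {k : ℕ} (C : Matrix (Fin k) (Fin k) ℂ) (μ : ℂ)
    (h1 : (C - μ • (1 : Matrix (Fin k) (Fin k) ℂ)) ^ k = 0)
    (h2 : (C - μ • (1 : Matrix (Fin k) (Fin k) ℂ)) ^ (k - 1) ≠ 0) :
    ∃ T : Matrix (Fin k) (Fin k) ℂ, IsUnit T ∧ C * T = T * Jblock k μ := by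
  set N := C - μ • (1 : Matrix (Fin k) (Fin k) ℂ) with hN
  obtain ⟨i0, j0, hij⟩ : ∃ i j, (N ^ (k - 1)) i j ≠ 0 := by
    by_contra hcon
    push Not at hcon
    exact h2 (by ext i j; simpa using hcon i j)
  let x : Fin k → ℂ := Pi.single j0 1
  refine ⟨chainM C μ k x, ?_, mul_chainM C μ k x (by rw [← hN, h1, Matrix.zero_mulVec])⟩
  let W : Matrix (Fin k) (Fin k) ℂ := Matrix.of fun a j => (N ^ (a : ℕ)) i0 j
  have hWT : ∀ a j, (W * chainM C μ k x) a j = ((N ^ ((a : ℕ) + (k - 1 - (j : ℕ)))) *ᵥ x) i0 := by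
    intro a j
    rw [pow_add, ← Matrix.mulVec_mulVec]
    simp [Matrix.mul_apply, Matrix.mulVec, dotProduct, chainM, W, ← hN]
  have hu : IsUnit (W * chainM C μ k x) := by
    refine isUnit_of_level _ (id : Fin k → Fin k) (fun j : Fin k => k - (j : ℕ)) ?_ ?_
    · intro i
      rw [id, hWT, show (i : ℕ) + (k - 1 - (i : ℕ)) = k - 1 by omega]
      simpa [x] using hij
    · intro i j hj hl
      have h3 : (j : ℕ) ≠ i := fun h => hj (Fin.ext h)
      rw [id, hWT]
      have h4 : (i : ℕ) + (k - 1 - (j : ℕ)) = ((i : ℕ) - 1 - (j : ℕ)) + k := by omega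
      rw [h4, pow_add, h1, Matrix.mul_zero, Matrix.zero_mulVec]; rfl
  rw [Matrix.isUnit_iff_isUnit_det] at hu ⊢
  rw [Matrix.det_mul] at hu
  exact isUnit_of_mul_isUnit_right hu

theorem up_pow {k : ℕ} (N : Matrix (Fin k) (Fin k) ℂ) (c : ℂ)
    (h0 : ∀ i j : Fin k, (j : ℕ) ≤ i → N i j = 0)
    (h1 : ∀ i j : Fin k, (j : ℕ) = i + 1 → N i j = c) (s : ℕ) :
    ∀ i j : Fin k, ((j : ℕ) < i + s → (N ^ s) i j = 0) ∧ ((j : ℕ) = i + s → (N ^ s) i j = c ^ s) := by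
  induction s with
  | zero =>
    intro i j
    refine ⟨fun h => ?_, fun h => ?_⟩
    · have : i ≠ j := by rintro rfl; omega
      simp [this]
    · have : i = j := Fin.ext (by omega)
      simp [this]
  | succ s ih =>
    intro i j
    rw [pow_succ, Matrix.mul_apply]
    refine ⟨fun h => ?_, fun h => ?_⟩
    · apply Finset.sum_eq_zero
      intro l _
      by_cases hl : (l : ℕ) < i + s
      · rw [(ih i l).1 hl, zero_mul]
      · rw [h0 l j (by omega), mul_zero]
    · rw [Finset.sum_eq_single ⟨(i : ℕ) + s, by omega⟩]
      · rw [(ih _ _).2 rfl, h1 _ _ (by simp; omega), pow_succ]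
      · intro l _ hl
        by_cases hl2 : (l : ℕ) < i + s
        · rw [(ih i l).1 hl2, zero_mul]
        · have : (l : ℕ) ≠ i + s := fun h => hl (Fin.ext h)
          rw [h0 l j (by omega), mul_zero]
      · simp

theorem up_pow_zero {k : ℕ} (N : Matrix (Fin k) (Fin k) ℂ) (c : ℂ)
    (h0 : ∀ i j : Fin k, (j : ℕ) ≤ i → N i j = 0)
    (h1 : ∀ i j : Fin k, (j : ℕ) = i + 1 → N i j = c) : N ^ k = 0 := by
  ext i j
  exact (up_pow N c h0 h1 k i j).1 (by omega)

theorem up_pow_ne {k : ℕ} (hk : 1 ≤ k) (N : Matrix (Fin k) (Fin k) ℂ) (c : ℂ) (hc : c ≠ 0)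
    (h0 : ∀ i j : Fin k, (j : ℕ) ≤ i → N i j = 0)
    (h1 : ∀ i j : Fin k, (j : ℕ) = i + 1 → N i j = c) : N ^ (k - 1) ≠ 0 := by
  intro h
  have := (up_pow N c h0 h1 (k - 1) ⟨0, by omega⟩ ⟨k - 1, by omega⟩).2 (by simp)
  rw [h] at this
  exact pow_ne_zero _ hc this.symm

theorem Jblock_sub {k : ℕ} (μ : ℂ) : Jblock k μ - μ • (1 : Matrix (Fin k) (Fin k) ℂ) = Jblock k 0 := by
  ext i j
  by_cases h : (j : ℕ) = i
  · have : i = j := Fin.ext h.symm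
    subst this
    simp [Jblock]
  · have : i ≠ j := fun h' => h (by rw [h'])
    simp [Jblock, h, this]

theorem Jzero_pow {k : ℕ} : (Jblock k 0) ^ k = 0 :=
  up_pow_zero _ 1 (by intro i j h; simp [Jblock]; omega) (by intro i j h; simp [Jblock, h])

theorem Jzero_pow_ne {k : ℕ} (hk : 1 ≤ k) : (Jblock k 0) ^ (k - 1) ≠ 0 :=
  up_pow_ne hk _ 1 one_ne_zero (by intro i j h; simp [Jblock]; omega)
    (by intro i j h; simp [Jblock, h])

theorem isUnit_Jblock {k : ℕ} {μ : ℂ} (hμ : μ ≠ 0) : IsUnit (Jblock k μ) := by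
  refine isUnit_of_level _ (id : Fin k → Fin k) (fun j : Fin k => k - (j : ℕ)) ?_ ?_
  · intro i; simp [Jblock, hμ]
  · intro i j hj hl
    have : (j : ℕ) ≠ i := fun h => hj (Fin.ext h)
    simp [Jblock, this]; omega

theorem isUnit_inv_pair {κ : Type*} [Fintype κ] [DecidableEq κ] {Q : Matrix κ κ ℂ} (h : IsUnit Q) :
    Q * Q⁻¹ = 1 ∧ Q⁻¹ * Q = 1 := by
  have := (Matrix.isUnit_iff_isUnit_det Q).1 h
  exact ⟨Matrix.mul_nonsing_inv _ this, Matrix.nonsing_inv_mul _ this⟩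

/-- A nonsingular matrix whose cosquare is similar to `J`. -/
theorem se_of_cosquare {κ τ : Type*} [Fintype κ] [DecidableEq κ] [Fintype τ] [DecidableEq τ]
    (K : Matrix κ κ ℂ) (hK : IsUnit Kᵀ) (J : Matrix κ κ ℂ)
    (X : Matrix κ κ ℂ) (hX : IsUnit X) (h : K * X = Kᵀ * X * J) : SE K Kᵀ J 1 := by
  obtain ⟨a1, a2⟩ := isUnit_inv_pair (hK.mul hX)
  obtain ⟨b1, b2⟩ := isUnit_inv_pair hX
  refine ⟨Kᵀ * X, (Kᵀ * X)⁻¹, X⁻¹, X, a1, a2, b2, b1, ?_, ?_⟩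
  · rw [← h, Matrix.mul_assoc, b1, Matrix.mul_one]
  · rw [Matrix.mul_one, Matrix.mul_assoc, b1, Matrix.mul_one]

theorem Gamma_apply {k : ℕ} (i j : Fin k) : Gamma k i j =
    if (i : ℕ) + (j : ℕ) = k - 1 ∨ (i : ℕ) + (j : ℕ) = k then
      (-1 : ℂ) ^ (k - 1 - (i : ℕ)) else 0 := rfl

theorem isUnit_GammaT {k : ℕ} : IsUnit (Gamma k)ᵀ := by
  refine isUnit_of_level _ Fin.rev (fun j : Fin k => k - (j : ℕ)) ?_ ?_
  · intro i
    rw [Matrix.transpose_apply, Gamma_apply, if_pos]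
    · exact pow_ne_zero _ (by norm_num)
    · left; simp [Fin.val_rev]; omega
  · intro i j hj hl
    have : (j : ℕ) ≠ i := fun h => hj (Fin.ext h)
    rw [Matrix.transpose_apply, Gamma_apply, if_neg]
    simp [Fin.val_rev]; omega

/-- The all-ones strictly upper triangular matrix. -/
def upOnes (k : ℕ) : Matrix (Fin k) (Fin k) ℂ := Matrix.of fun i j => if (i : ℕ) < j then 1 else 0

theorem Gamma_cosq {k : ℕ} : (Gamma k)ᵀ * ((-1 : ℂ) ^ (k + 1) • (1 + (2 : ℂ) • upOnes k)) = Gamma k := by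
  ext i b
  have key : ∀ f : Fin k → ℂ, ((Gamma k)ᵀ *ᵥ f) i = (-1 : ℂ) ^ (i : ℕ) *
      (f (Fin.rev i) - if h : 0 < (i : ℕ) then f ⟨k - i, by omega⟩ else 0) := by
    intro f
    simp only [Matrix.mulVec, dotProduct, Matrix.transpose_apply, Gamma_apply]
    have hs : ∀ l : Fin k, (if (l : ℕ) + (i : ℕ) = k - 1 ∨ (l : ℕ) + (i : ℕ) = k then
      (-1 : ℂ) ^ (k - 1 - (l : ℕ)) else 0) * f l = (if l = Fin.rev i then (-1 : ℂ) ^ (i : ℕ) * f l else 0)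
        + (if (l : ℕ) + i = k then - (-1 : ℂ) ^ (i : ℕ) * f l else 0) := by
      intro l
      have e1 : l = Fin.rev i ↔ (l : ℕ) + i = k - 1 := by
        rw [Fin.ext_iff, Fin.val_rev]; omega
      by_cases h1 : (l : ℕ) + i = k - 1
      · rw [if_pos (Or.inl h1), if_pos (e1.2 h1), if_neg (by omega),
          show k - 1 - (l : ℕ) = i by omega, add_zero]
      · rw [if_neg (fun h => h1 (e1.1 h)), zero_add]
        by_cases h2 : (l : ℕ) + i = k
        · rw [if_pos (Or.inr h2), if_pos h2]
          obtain ⟨i', hi'⟩ : ∃ i', (i : ℕ) = i' + 1 := ⟨i - 1, by omega⟩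
          rw [show k - 1 - (l : ℕ) = i' by omega, hi', pow_succ]; ring
        · rw [if_neg h2, if_neg (by tauto), zero_mul]
    rw [Finset.sum_congr rfl (fun l _ => hs l), Finset.sum_add_distrib, mul_sub, sub_eq_add_neg]
    congr 1
    · simp
    · split_ifs with h
      · rw [Finset.sum_eq_single ⟨k - i, by omega⟩]
        · rw [if_pos (show k - (i : ℕ) + i = k by omega)]; ring
        · intro l _ hl
          rw [if_neg]
          intro h'; apply hl; ext; simp; omega
        · simp
      · rw [Finset.sum_eq_zero]
        · simp
        · intro l _; rw [if_neg (by omega)]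
  have e : ((Gamma k)ᵀ * ((-1 : ℂ) ^ (k + 1) • (1 + (2 : ℂ) • upOnes k))) i b =
      ((Gamma k)ᵀ *ᵥ (fun l => (-1 : ℂ) ^ (k + 1) *
        ((if (l : ℕ) = b then 1 else 0) + 2 * (if (l : ℕ) < b then 1 else 0)))) i := by
    simp only [Matrix.mul_apply, Matrix.mulVec, dotProduct]
    apply Finset.sum_congr rfl
    intro l _
    simp [upOnes, Matrix.one_apply, Fin.ext_iff]
  rw [e, key, Gamma_apply]
  have hpar : (-1 : ℂ) ^ (i : ℕ) * (-1 : ℂ) ^ (k + 1) = (-1 : ℂ) ^ (k - 1 - (i : ℕ)) := by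
    rw [← pow_add, show (i : ℕ) + (k + 1) = (k - 1 - (i : ℕ)) + 2 * (i + 1) by omega, pow_add,
      pow_mul]
    simp
  rw [← hpar]
  have hrev : ((Fin.rev i : Fin k) : ℕ) = k - 1 - i := by rw [Fin.val_rev]; omega
  rw [hrev]
  by_cases h0 : 0 < (i : ℕ)
  · rw [dif_pos h0]
    dsimp only
    split_ifs <;> first | (exfalso; omega) | ring
  · rw [dif_neg h0]
    split_ifs <;> first | (exfalso; omega) | ring

theorem se_Gamma {k : ℕ} (hk : 1 ≤ k) :
    SE (Gamma k) (Gamma k)ᵀ (Jblock k ((-1) ^ (k + 1))) 1 := by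
  set ε : ℂ := (-1) ^ (k + 1) with hε
  have hε0 : ε ≠ 0 := pow_ne_zero _ (by norm_num)
  set C : Matrix (Fin k) (Fin k) ℂ := ε • (1 + (2 : ℂ) • upOnes k) with hC
  have hN : C - ε • (1 : Matrix (Fin k) (Fin k) ℂ) = (2 * ε) • upOnes k := by
    rw [hC, smul_add, smul_smul, mul_comm]; abel
  have a0 : ∀ i j : Fin k, (j : ℕ) ≤ i → ((2 * ε) • upOnes k) i j = 0 := by
    intro i j h; simp [upOnes]; intro; omega
  have a1 : ∀ i j : Fin k, (j : ℕ) = i + 1 → ((2 * ε) • upOnes k) i j = 2 * ε := by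
    intro i j h; simp [upOnes]; intro; omega
  obtain ⟨T, hT, hCT⟩ := jordan_lemma C ε (by rw [hN]; exact up_pow_zero _ _ a0 a1)
    (by rw [hN]; exact up_pow_ne hk _ _ (mul_ne_zero two_ne_zero hε0) a0 a1)
  refine se_of_cosquare (τ := Fin k) _ isUnit_GammaT _ T hT ?_
  rw [Matrix.mul_assoc, ← hCT, ← Matrix.mul_assoc, hC, hε, Gamma_cosq]

theorem se_H {k : ℕ} (hk : 1 ≤ k) {μ : ℂ} (hμ : μ ≠ 0) :
    SE (Matrix.fromBlocks 0 1 (Jblock k μ) 0) (Matrix.fromBlocks 0 1 (Jblock k μ) 0)ᵀ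
      (Matrix.fromBlocks (Jblock k μ) 0 0 (Jblock k μ⁻¹)) 1 := by
  set J := Jblock k μ with hJ
  have hJu : IsUnit Jᵀ := (Matrix.isUnit_transpose _).2 (isUnit_Jblock hμ)
  obtain ⟨j1, j2⟩ := isUnit_inv_pair hJu
  have hM : (Jblock k 0)ᵀ = Jᵀ - μ • (1 : Matrix (Fin k) (Fin k) ℂ) := by
    rw [← Jblock_sub μ]; simp [hJ]
  have hN : Jᵀ⁻¹ - μ⁻¹ • (1 : Matrix (Fin k) (Fin k) ℂ) = (-μ⁻¹) • (Jᵀ⁻¹ * (Jblock k 0)ᵀ) := by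
    rw [hM, Matrix.mul_sub, j2, mul_smul_comm, Matrix.mul_one, smul_sub, smul_smul]
    simp [hμ]; abel
  have hcomm : Commute Jᵀ⁻¹ (Jblock k 0)ᵀ := by
    rw [hM]
    show Jᵀ⁻¹ * _ = _ * Jᵀ⁻¹
    rw [Matrix.mul_sub, Matrix.sub_mul, j1, j2]; simp
  have hpow : ∀ s, (Jᵀ⁻¹ - μ⁻¹ • (1 : Matrix (Fin k) (Fin k) ℂ)) ^ s =
      (-μ⁻¹) ^ s • (Jᵀ⁻¹ ^ s * ((Jblock k 0) ^ s)ᵀ) := by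
    intro s
    rw [hN, smul_pow, hcomm.mul_pow, Matrix.transpose_pow]
  have hne : (Jᵀ⁻¹ - μ⁻¹ • (1 : Matrix (Fin k) (Fin k) ℂ)) ^ (k - 1) ≠ 0 := by
    rw [hpow]
    intro h
    have h2 := (smul_eq_zero.1 h).resolve_left (pow_ne_zero _ (neg_ne_zero.2 (inv_ne_zero hμ)))
    have h3 : (Jᵀ) ^ (k - 1) * (Jᵀ⁻¹ ^ (k - 1) * ((Jblock k 0) ^ (k - 1))ᵀ) = 0 := by
      rw [h2, Matrix.mul_zero]
    have hc : Commute Jᵀ Jᵀ⁻¹ := by show _ * _ = _ * _; rw [j1, j2]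
    rw [← Matrix.mul_assoc, ← hc.mul_pow, j1, one_pow, Matrix.one_mul] at h3
    exact Jzero_pow_ne hk (Matrix.transpose_eq_zero.1 h3)
  obtain ⟨T, hT, hCT⟩ := jordan_lemma Jᵀ⁻¹ μ⁻¹ (by rw [hpow, Jzero_pow]; simp) hne
  obtain ⟨t1, t2⟩ := isUnit_inv_pair hT
  refine se_of_cosquare (τ := Fin k) _ ?_ _ (Matrix.fromBlocks 1 0 0 T) ?_ ?_
  · refine IsUnit.of_mul_eq_one (Matrix.fromBlocks 0 1 Jᵀ⁻¹ 0) ?_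
    rw [Matrix.fromBlocks_transpose, Matrix.fromBlocks_multiply]
    simp [j1, Matrix.fromBlocks_one]
  · refine IsUnit.of_mul_eq_one (Matrix.fromBlocks 1 0 0 T⁻¹) ?_
    rw [Matrix.fromBlocks_multiply]
    simp [t1, Matrix.fromBlocks_one]
  · simp only [Matrix.fromBlocks_transpose, Matrix.fromBlocks_multiply]
    simp only [Matrix.zero_mul, Matrix.mul_zero, Matrix.mul_one, Matrix.one_mul, zero_add, add_zero,
      Matrix.transpose_zero, Matrix.transpose_one]
    rw [Matrix.mul_assoc, ← hCT, ← Matrix.mul_assoc, j1, Matrix.one_mul]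

end part3

section part4

/-- Solvability of linear equations in a bilinear form. -/
theorem form_solve {V : Type*} [AddCommGroup V] [Module ℂ V] [FiniteDimensional ℂ V]
    (B : V →ₗ[ℂ] V →ₗ[ℂ] ℂ) (S : Submodule ℂ V) (f : V →ₗ[ℂ] ℂ)
    (h : ∀ w, (∀ l ∈ S, B w l = 0) → f w = 0) : ∃ l ∈ S, ∀ v, B v l = f v := by
  have h1 : f ∈ (S.map B.flip).dualCoannihilator.dualAnnihilator := by
    rw [Submodule.mem_dualAnnihilator]
    intro w hw
    rw [Submodule.mem_dualCoannihilator] at hw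
    exact h w (fun l hl => hw _ (Submodule.mem_map_of_mem hl))
  rw [Subspace.dualCoannihilator_dualAnnihilator_eq] at h1
  obtain ⟨l, hl, rfl⟩ := h1
  exact ⟨l, hl, fun v => rfl⟩

/-- A nondegenerate chain in a bilinear form, giving a singular canonical block. -/
def SingChain {V : Type*} [AddCommGroup V] [Module ℂ V] (B : V →ₗ[ℂ] V →ₗ[ℂ] ℂ) : Prop :=
  ∃ k : ℕ, 1 ≤ k ∧ ∃ (e : ℕ → V) (ψ : ℕ → V →ₗ[ℂ] ℂ),
    (∀ v, B v (e 0) = 0) ∧ (∀ v, B (e (k - 1)) v = 0) ∧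
    (∀ i, i + 1 < k → (∀ v, B v (e (i + 1)) = ψ i v) ∧ (∀ v, B (e i) v = ψ (i + 1) v)) ∧
    (∀ c : ℕ → ℂ, (∀ i < k, ∑ j ∈ Finset.range k, c j * ψ i (e j) = 0) → ∀ j < k, c j = 0)

theorem singChain_exists (N : ℕ) : ∀ {V : Type} [AddCommGroup V] [Module ℂ V]
    [FiniteDimensional ℂ V] (B : V →ₗ[ℂ] V →ₗ[ℂ] ℂ), Module.finrank ℂ V = N →
    (∃ r, r ≠ 0 ∧ ∀ v, B v r = 0) → SingChain B := by
  induction N using Nat.strong_induction_on with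
  | _ N IH =>
  intro V _ _ _ B hN hsing
  obtain ⟨r0, hr0, hr0'⟩ := hsing
  set L : Submodule ℂ V := LinearMap.ker B with hL
  set R : Submodule ℂ V := LinearMap.ker B.flip with hR
  have memL : ∀ l, l ∈ L ↔ ∀ v, B l v = 0 := by
    intro l; rw [hL, LinearMap.mem_ker]
    exact ⟨fun h v => by rw [h]; rfl, fun h => LinearMap.ext h⟩
  have memR : ∀ l, l ∈ R ↔ ∀ v, B v l = 0 := by
    intro l; rw [hR, LinearMap.mem_ker]
    exact ⟨fun h v => by rw [← LinearMap.flip_apply, h]; rfl, fun h => LinearMap.ext h⟩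
  by_cases c1 : ∃ w, w ≠ 0 ∧ w ∈ L ∧ w ∈ R
  · obtain ⟨w, hw, hwL, hwR⟩ := c1
    have hne : ¬ ∀ φ : Module.Dual ℂ V, φ w = 0 := fun h =>
      hw ((Module.forall_dual_apply_eq_zero_iff ℂ w).1 h)
    push Not at hne
    obtain ⟨f, hf⟩ := hne
    refine ⟨1, le_rfl, fun _ => w, fun _ => f, (memR w).1 hwR, (memL w).1 hwL,
      fun i hi => by omega, ?_⟩
    intro c hc j hj
    obtain rfl : j = 0 := by omega
    have := hc 0 (by norm_num)
    rw [Finset.sum_range_one] at this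
    exact (mul_eq_zero.1 this).resolve_right hf
  by_cases c2 : ∃ r ∈ R, ∃ l ∈ L, B r l ≠ 0
  · obtain ⟨r, hr, l, hl, hrl⟩ := c2
    rw [memR] at hr
    rw [memL] at hl
    refine ⟨2, by norm_num, fun i => if i = 0 then r else l,
      fun i => if i = 0 then B.flip l else B r, ?_, ?_, ?_, ?_⟩
    · simpa using hr
    · simpa using hl
    · intro i hi
      obtain rfl : i = 0 := by omega
      simp
    · intro c hc j hj
      have h0 := hc 0 (by norm_num)
      have h1 := hc 1 (by norm_num)
      simp [Finset.sum_range_succ, hl, hr, hrl] at h0 h1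
      interval_cases j
      · exact h0
      · exact h1
  push Not at c1 c2
  -- the subspace V1
  let V1 : Submodule ℂ V :=
    { carrier := {w | ∀ l ∈ L, B w l = 0}
      add_mem' := by intro a b ha hb l hl; simp [ha l hl, hb l hl]
      zero_mem' := by intro l _; simp
      smul_mem' := by intro c a ha l hl; simp [ha l hl] }
  have memV1 : ∀ w, w ∈ V1 ↔ ∀ l ∈ L, B w l = 0 := fun w => Iff.rfl
  have hLV1 : ∀ l ∈ L, l ∈ V1 := fun l hl l' _ => (memL l).1 hl l'
  have hRV1 : ∀ l ∈ R, l ∈ V1 := fun l hl l' hl' => c2 l hl l' hl'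
  have hdis : Disjoint R L := by
    rw [Submodule.disjoint_def]
    intro x hx hx'
    by_contra hne
    exact c1 x hne hx' hx
  obtain ⟨M0, hRM0, hcompl⟩ := hdis.exists_isCompl
  set M : Submodule ℂ V := M0 ⊓ V1 with hM
  have hdec : ∀ v ∈ V1, ∃ m ∈ M, ∃ l ∈ L, v = m + l := by
    intro v hv
    have : v ∈ M0 ⊔ L := by rw [hcompl.sup_eq_top]; trivial
    obtain ⟨m, hm, l, hl, rfl⟩ := Submodule.mem_sup.1 this
    refine ⟨m, ⟨hm, ?_⟩, l, hl, rfl⟩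
    have := V1.sub_mem hv (hLV1 l hl)
    simpa using this
  have hML : ∀ m ∈ M, m ∈ L → m = 0 := fun m hm hl =>
    (Submodule.disjoint_def.1 hcompl.disjoint) m hm.1 hl
  have hP : ∀ f : V →ₗ[ℂ] ℂ, (∀ m ∈ M, f m = 0) → (∀ l ∈ L, f l = 0) →
      ∃ l ∈ L, ∀ v, B v l = f v := by
    intro f h1 h2
    apply form_solve
    intro w hw
    obtain ⟨m, hm, l, hl, rfl⟩ := hdec w hw
    rw [map_add, h1 m hm, h2 l hl, add_zero]
  have hQ : ∀ f : V →ₗ[ℂ] ℂ, (∀ l ∈ L, f l = 0) → ∃ u, ∀ v, B v u = f v := by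
    intro f h2
    obtain ⟨u, _, hu⟩ := form_solve B ⊤ f (fun w hw => h2 w ((memL w).2 fun v => hw v trivial))
    exact ⟨u, hu⟩
  have hL0 : L ≠ ⊥ := by
    intro hbot
    have hs : Function.Surjective B.flip := by
      intro f
      obtain ⟨u, hu⟩ := hQ f (fun l hl => by rw [hbot, Submodule.mem_bot] at hl; simp [hl])
      exact ⟨u, LinearMap.ext hu⟩
    have hi := (LinearMap.injective_iff_surjective_of_finrank_eq_finrank
      (Subspace.dual_finrank_eq (K := ℂ) (V := V)).symm).2 hs
    exact hr0 (hi (by rw [map_zero]; exact LinearMap.ext hr0'))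
  have hMlt : Module.finrank ℂ M < N := by
    rw [← hN]
    apply Submodule.finrank_lt
    intro htop
    apply hL0
    rw [eq_bot_iff]
    intro l hl
    exact hML l (by rw [htop]; trivial) hl
  have hr0R : r0 ∈ R := (memR r0).2 hr0'
  have hr0M : r0 ∈ M := ⟨hRM0 hr0R, hRV1 _ hr0R⟩
  obtain ⟨k, hk, e', ψ', ha, hb, hc, hd⟩ := IH _ hMlt (B.domRestrict₁₂ M M) rfl
    ⟨⟨r0, hr0M⟩, by simpa [Submodule.mk_eq_zero] using hr0, fun v => hr0' v⟩
  simp only [LinearMap.domRestrict₁₂_apply] at ha hb hc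
  have heM : ∀ i, (e' i : V) ∈ M := fun i => (e' i).2
  have heL : ∀ i, ∀ l ∈ L, B (e' i) l = 0 := fun i l hl => (heM i).2 l hl
  have hBL : ∀ l ∈ L, ∀ v, B l v = 0 := fun l hl => (memL l).1 hl
  -- corrections
  obtain ⟨l0, hl0, hl0'⟩ := hP (-(B.flip (e' 0 : V)))
    (fun m hm => by simpa using ha ⟨m, hm⟩) (fun l hl => by simp [hBL l hl])
  have hstep : ∀ i, ∃ l ∈ L, i + 2 < k → ∀ v, B v ((e' (i + 2) : V) + l) = B (e' i) v := by
    intro i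
    by_cases hi : i + 2 < k
    · obtain ⟨l, hl, hl'⟩ := hP (B (e' i) - (B.flip (e' (i + 2) : V)))
        (fun m hm => by
          have h1 := (hc (i + 1) (by omega)).1 ⟨m, hm⟩
          have h2 := (hc i (by omega)).2 ⟨m, hm⟩
          simp only [LinearMap.sub_apply, LinearMap.flip_apply]
          rw [h1, h2, sub_self]) (fun l hl => by simp [hBL l hl, heL i l hl])
      exact ⟨l, hl, fun _ v => by rw [map_add, hl']; simp⟩
    · exact ⟨0, L.zero_mem, fun h => absurd h hi⟩
  choose ls hls hls' using hstep
  obtain ⟨lk, hlk, hlk'⟩ := hP (B (e' (k - 1)))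
    (fun m hm => hb ⟨m, hm⟩) (fun l hl => heL _ l hl)
  let ll : ℕ → V := fun i => if i = 0 then l0 else if i = 1 then 0 else ls (i - 2)
  have hll : ∀ i, ll i ∈ L := by
    intro i; simp only [ll]; split_ifs
    · exact hl0
    · exact L.zero_mem
    · exact hls _
  -- the vector u
  have hu : ∃ u, (∀ i, i + 2 = k → ∀ v, B v u = B (e' i) v) ∧ B (e' (k - 1)) u ≠ 0 := by
    have hne : ∀ j < k, e' j ≠ 0 := by
      intro j hj h
      have := hd (fun i => if i = j then 1 else 0) (by
        intro i hi
        apply Finset.sum_eq_zero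
        intro j' _
        by_cases hj' : j' = j
        · rw [hj', h, map_zero, mul_zero]
        · simp [hj']) j hj
      simp at this
    by_cases h1 : k = 1
    · subst h1
      have : ¬ ((e' 0 : V) ∈ L) := fun h => hne 0 (by norm_num)
        (Subtype.ext (hML _ (heM 0) h))
      rw [memL] at this
      push Not at this
      obtain ⟨u, hu⟩ := this
      exact ⟨u, fun i hi => by omega, hu⟩
    · obtain ⟨u, hu⟩ := hQ (B (e' (k - 2))) (fun l hl => heL _ l hl)
      refine ⟨u, fun i hi v => by rw [hu, show k - 2 = i by omega], ?_⟩
      rw [hu]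
      intro h0
      have := hd (fun i => if i = k - 1 then 1 else 0) (by
        intro i hi
        rw [Finset.sum_eq_single (k - 1)]
        · rw [if_pos rfl, one_mul]
          by_cases hi' : i = k - 1
          · have h3 := (hc (k - 2) (by omega)).2 (e' (k - 1))
            rw [h0, show k - 2 + 1 = k - 1 by omega] at h3
            rw [hi', ← h3]
          · rw [← (hc i (by omega)).1, hb]
        · intro j _ hj; rw [if_neg hj, zero_mul]
        · intro h; exact absurd (Finset.mem_range.2 (by omega)) h) (k - 1) (by omega)
      simp at this
  obtain ⟨u, hu, hγ⟩ := hu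
  let e : ℕ → V := fun i => if i < k then e' i + ll i else if i = k then u else lk
  let ψ : ℕ → V →ₗ[ℂ] ℂ := fun i => if i ≤ k then B.flip (e (i + 1)) else B (e k)
  have ei : ∀ i, i < k → e i = e' i + ll i := fun i hi => by simp only [e]; rw [if_pos hi]
  have ek : e k = u := by simp [e]
  have ek1 : e (k + 1) = lk := by simp [e]
  have Bei : ∀ i, i < k → ∀ v, B (e i) v = B (e' i) v := by
    intro i hi v; rw [ei i hi, map_add, LinearMap.add_apply, hBL _ (hll i), add_zero]
  have Bee : ∀ i j, i < k → j < k → B (e i) (e j) = B (e' i) (e' j) := by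
    intro i j hi hj; rw [Bei i hi, ei j hj, map_add, heL i _ (hll j), add_zero]
  have ψi : ∀ i, i ≤ k → ∀ v, ψ i v = B v (e (i + 1)) := by
    intro i hi v; simp only [ψ]; rw [if_pos hi]; rfl
  have ψk : ∀ v, ψ (k + 1) v = B u v := by
    intro v; simp only [ψ]; rw [if_neg (by omega), ek]
  have hγ2 : B u lk ≠ 0 := by rw [hlk']; exact hγ
  refine ⟨k + 2, by omega, e, ψ, ?_, ?_, ?_, ?_⟩
  · intro v
    rw [ei 0 (by omega), map_add]
    simp [ll, hl0']
  · intro v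
    rw [show k + 2 - 1 = k + 1 by omega, ek1, hBL _ hlk]
  · intro i hi
    refine ⟨fun v => (ψi i (by omega) v).symm, fun v => ?_⟩
    by_cases h1 : i = k
    · rw [h1, ψk, ek]
    rw [ψi (i + 1) (by omega), Bei i (by omega)]
    by_cases h2 : i + 2 < k
    · rw [ei _ h2, ← hls' i h2 v]; simp [ll]
    by_cases h3 : i + 2 = k
    · rw [show i + 1 + 1 = k by omega, ek, hu i h3]
    · rw [show i + 1 + 1 = k + 1 by omega, ek1, hlk', show k - 1 = i by omega]
  · intro c hcc
    have hck : c k = 0 := by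
      have := hcc k (by omega)
      rw [Finset.sum_range_succ, Finset.sum_range_succ, Finset.sum_eq_zero] at this
      · rw [ψi k le_rfl, ψi k le_rfl, ek1, ek, hBL _ hlk, mul_zero, add_zero, zero_add] at this
        exact (mul_eq_zero.1 this).resolve_right hγ2
      · intro j hj
        rw [ψi k le_rfl, ek1, Bei j (Finset.mem_range.1 hj), heL j _ hlk, mul_zero]
    have hcc' : ∀ i < k + 2, ∑ j ∈ Finset.range k, c j * ψ i (e j) + c (k + 1) * ψ i lk = 0 := by
      intro i hi
      have := hcc i hi
      rwa [Finset.sum_range_succ, Finset.sum_range_succ, hck, zero_mul, add_zero, ek1] at this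
    have hcj : ∀ j < k, c j = 0 := by
      by_cases h1 : k = 1
      · intro j hj
        have := hcc' 0 (by omega)
        obtain rfl : j = 0 := by omega
        rw [ψi 0 (by omega), hBL _ hlk, mul_zero, add_zero, h1, Finset.sum_range_one,
          ψi 0 (by omega), Bei 0 (by omega), zero_add, ← h1, ek] at this
        rw [h1] at hγ
        exact (mul_eq_zero.1 this).resolve_right hγ
      · apply hd c
        intro i hi
        have := hcc' i (by omega)
        rw [ψi i (by omega) lk, hBL _ hlk, mul_zero, add_zero] at this
        rw [← this]
        apply Finset.sum_congr rfl
        intro j hj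
        have hj := Finset.mem_range.1 hj
        congr 1
        rw [ψi i (by omega)]
        by_cases h2 : i + 1 < k
        · rw [Bee j (i + 1) hj h2, (hc i h2).1]
        · have h3 : i + 1 = k := by omega
          rw [h3, ek, hu (k - 2) (by omega), ← Bei (k - 2) (by omega), Bee _ _ (by omega) hj,
            (hc (k - 2) (by omega)).2, show k - 2 + 1 = i by omega]
    intro j hj
    by_cases h1 : j < k
    · exact hcj j h1
    by_cases h2 : j = k
    · rw [h2, hck]
    obtain rfl : j = k + 1 := by omega
    have := hcc' (k + 1) (by omega)
    rw [Finset.sum_eq_zero (fun j hj => by rw [hcj j (Finset.mem_range.1 hj), zero_mul]), zero_add,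
      ψk] at this
    exact (mul_eq_zero.1 this).resolve_right hγ2

theorem mul_JblockT_apply {ι : Type*} {k : ℕ} (M : Matrix ι (Fin k) ℂ) (i : ι) (j : Fin k) :
    (M * (Jblock k 0)ᵀ) i j = (if h : (j : ℕ) + 1 < k then M i ⟨j + 1, h⟩ else 0) := by
  have hs : ∀ l : Fin k, M i l * (Jblock k 0)ᵀ l j = (if (l : ℕ) = j + 1 then M i l else 0) := by
    intro l
    simp only [Jblock, Matrix.transpose_apply, Matrix.of_apply]
    by_cases h1 : (l : ℕ) = j
    · simp [h1]
    · simp [h1]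
  rw [Matrix.mul_apply, Finset.sum_congr rfl (fun l _ => hs l)]
  split_ifs with h
  · rw [Finset.sum_eq_single ⟨j + 1, h⟩]
    · simp
    · intro b _ hb
      rw [if_neg]
      intro hjb
      exact hb (Fin.ext hjb)
    · simp
  · apply Finset.sum_eq_zero
    intro l _
    rw [if_neg (by omega)]

/-- A singular matrix splits off a type 0 block. -/
theorem sing_split {n : ℕ} (A : Matrix (Fin n) (Fin n) ℂ) (hA : ¬ IsUnit A) :
    ∃ (k : ℕ) (_ : 1 ≤ k) (d : ℕ) (A' : Matrix (Fin d) (Fin d) ℂ),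
      Cong A (Matrix.fromBlocks (Jblock k 0) 0 0 A') := by
  have hker : ∃ r, r ≠ 0 ∧ A *ᵥ r = 0 := by
    rw [Matrix.exists_mulVec_eq_zero_iff]
    by_contra h
    exact hA ((Matrix.isUnit_iff_isUnit_det A).2 (isUnit_iff_ne_zero.2 h))
  obtain ⟨r, hr, hr'⟩ := hker
  have hBapp : ∀ x y, Matrix.toLinearMap₂' ℂ A x y = x ⬝ᵥ (A *ᵥ y) := fun x y =>
    Matrix.toLinearMap₂'_apply' A x y
  obtain ⟨k, hk, e, ψ, ha, hb, hc, hd⟩ := singChain_exists _ (Matrix.toLinearMap₂' ℂ A) rfl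
    ⟨r, hr, fun v => by rw [hBapp, hr', dotProduct_zero]⟩
  simp only [hBapp] at ha hb hc
  let E : Matrix (Fin n) (Fin k) ℂ := Matrix.of fun a j => e j a
  let Φ : Matrix (Fin k) (Fin n) ℂ := Matrix.of fun i a => ψ i (Pi.single a 1)
  have hAE : ∀ a j, (A * E) a j = Pi.single a 1 ⬝ᵥ (A *ᵥ (e j)) := by
    intro a j; rw [single_one_dotProduct]; rfl
  have hAtE : ∀ a j, (Aᵀ * E) a j = (e j) ⬝ᵥ (A *ᵥ Pi.single a 1) := by
    intro a j; rw [dotProduct_mulVec, dotProduct_single_one, Matrix.mul_apply']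
    rw [Matrix.vecMul, dotProduct_comm]; rfl
  have hΦE : ∀ i j, (Φ * E) i j = ψ i (e j) := by
    intro i j
    rw [Matrix.mul_apply, LinearMap.pi_apply_eq_sum_univ (ψ i) (e j)]
    apply Finset.sum_congr rfl
    intro a _
    simp only [Φ, E, Matrix.of_apply, smul_eq_mul, mul_comm]
    congr 2
    ext b; simp [Pi.single_apply, eq_comm]
  have hmain : ∃ (d : ℕ) (A' : Matrix (Fin d) (Fin d) ℂ),
      Cong A (Matrix.fromBlocks (Jblock k 0) 0 0 A') := by
    refine split_lemma A (Jblock k 0) (Jblock k 0) (Jblock k 0)ᵀ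
      ⟨1, 1, 1, 1, by simp, by simp, by simp, by simp, by simp, by simp⟩ E Φ ?_ ?_ ?_
    · ext a j
      rw [hAE, mul_Jblock_apply, zero_mul, zero_add]
      split_ifs with h
      · have := (hc (j - 1) (by omega)).1 (Pi.single a 1)
        rw [show (j : ℕ) - 1 + 1 = j by omega] at this
        rw [this]; rfl
      · rw [show (j : ℕ) = 0 by omega, ha]
    · ext a j
      rw [hAtE, mul_JblockT_apply]
      split_ifs with h
      · rw [(hc j h).2]; rfl
      · rw [show (j : ℕ) = k - 1 by omega, hb]
    · rw [Matrix.isUnit_iff_isUnit_det, isUnit_iff_ne_zero]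
      intro h0
      obtain ⟨v, hv, hv'⟩ := Matrix.exists_mulVec_eq_zero_iff.2 h0
      apply hv
      ext j
      have := hd (fun j => if h : j < k then v ⟨j, h⟩ else 0) (by
        intro i hi
        have h1 := congrFun hv' ⟨i, hi⟩
        simp only [Matrix.mulVec, dotProduct, hΦE, Pi.zero_apply] at h1
        rw [← h1, Finset.sum_range]
        apply Finset.sum_congr rfl
        intro j _
        simp [mul_comm]) j j.2
      simpa using this
  obtain ⟨d, A', h⟩ := hmain
  exact ⟨k, hk, d, A', h⟩

end part4

section part5

section nonsing

variable {n : ℕ}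

/-- The shifted matrix `C - μ`. -/
abbrev sh (C : Matrix (Fin n) (Fin n) ℂ) (μ : ℂ) : Matrix (Fin n) (Fin n) ℂ := C - μ • 1

/-- The bilinear form of a matrix. -/
def bil (A : Matrix (Fin n) (Fin n) ℂ) (x y : Fin n → ℂ) : ℂ := x ⬝ᵥ (A *ᵥ y)

theorem bil_mul_left (A F : Matrix (Fin n) (Fin n) ℂ) (x y : Fin n → ℂ) :
    bil A (F *ᵥ x) y = bil (Fᵀ * A) x y := by
  unfold bil
  rw [← Matrix.mulVec_mulVec, Matrix.dotProduct_mulVec x Fᵀ, Matrix.vecMul_transpose]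

theorem bil_mul_right (A F : Matrix (Fin n) (Fin n) ℂ) (x y : Fin n → ℂ) :
    bil A x (F *ᵥ y) = bil (A * F) x y := by
  unfold bil
  rw [← Matrix.mulVec_mulVec]

theorem bil_add_left (A : Matrix (Fin n) (Fin n) ℂ) (x x' y : Fin n → ℂ) :
    bil A (x + x') y = bil A x y + bil A x' y := by simp [bil]

theorem bil_add_right (A : Matrix (Fin n) (Fin n) ℂ) (x y y' : Fin n → ℂ) :
    bil A x (y + y') = bil A x y + bil A x y' := by simp [bil, Matrix.mulVec_add]

theorem bil_smul_left (A : Matrix (Fin n) (Fin n) ℂ) (c : ℂ) (x y : Fin n → ℂ) :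
    bil A (c • x) y = c * bil A x y := by simp [bil]

theorem bil_smul_right (A : Matrix (Fin n) (Fin n) ℂ) (c : ℂ) (x y : Fin n → ℂ) :
    bil A x (c • y) = c * bil A x y := by simp [bil, Matrix.mulVec_smul]

theorem bil_smul_mat (A : Matrix (Fin n) (Fin n) ℂ) (c : ℂ) (x y : Fin n → ℂ) :
    bil (c • A) x y = c * bil A x y := by simp [bil, Matrix.smul_mulVec]

theorem bil_zero_right (A : Matrix (Fin n) (Fin n) ℂ) (x : Fin n → ℂ) : bil A x 0 = 0 := by simp [bil]

theorem bil_zero_left (A : Matrix (Fin n) (Fin n) ℂ) (x : Fin n → ℂ) : bil A 0 x = 0 := by simp [bil]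

/-- The data of a matrix with its cosquare `C` and the inverse `D` of the cosquare. -/
structure Cosq (A C D : Matrix (Fin n) (Fin n) ℂ) : Prop where
  hC : Aᵀ * C = A
  hCD : C * D = 1
  hDC : D * C = 1

theorem sh_mulVec (C : Matrix (Fin n) (Fin n) ℂ) (μ : ℂ) (x : Fin n → ℂ) :
    C *ᵥ x = μ • x + sh C μ *ᵥ x := by
  rw [Matrix.sub_mulVec, Matrix.smul_mulVec, Matrix.one_mulVec]; abel

theorem Cosq.flip {A C D : Matrix (Fin n) (Fin n) ℂ} (h : Cosq A C D) (x y : Fin n → ℂ) :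
    bil A (C *ᵥ x) y = bil A y x := by
  have : Cᵀ * A = Aᵀ := by
    conv_rhs => rw [← h.hC]
    simp
  rw [bil_mul_left, this]
  unfold bil
  rw [Matrix.dotProduct_mulVec, Matrix.vecMul_transpose, dotProduct_comm]

theorem Cosq.inv {A C D : Matrix (Fin n) (Fin n) ℂ} (h : Cosq A C D) (x y : Fin n → ℂ) :
    bil A (C *ᵥ x) (C *ᵥ y) = bil A x y := by
  rw [h.flip, h.flip]

theorem Cosq.adj1 {A C D : Matrix (Fin n) (Fin n) ℂ} (h : Cosq A C D) {μ : ℂ} (hμ : μ ≠ 0) :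
    (sh C μ)ᵀ * A = (-μ) • (A * D * sh C μ⁻¹) := by
  have h1 : Cᵀ * A = Aᵀ := by
    conv_rhs => rw [← h.hC]
    simp
  have h2 : Cᵀ * A = A * D := by
    have : Aᵀ * C * D = A * D := by rw [h.hC]
    rw [Matrix.mul_assoc, h.hCD, Matrix.mul_one] at this
    rw [h1, this]
  rw [Matrix.transpose_sub, Matrix.sub_mul, h2, Matrix.mul_sub, Matrix.mul_assoc A D C, h.hDC]
  simp [smul_sub, smul_smul, hμ]
  abel

theorem Cosq.commD {A C D : Matrix (Fin n) (Fin n) ℂ} (h : Cosq A C D) (μ : ℂ) :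
    Commute D (sh C μ) := by
  show D * _ = _ * D
  rw [Matrix.mul_sub, Matrix.sub_mul, h.hCD, h.hDC]; simp

theorem Cosq.adj {A C D : Matrix (Fin n) (Fin n) ℂ} (h : Cosq A C D) {μ : ℂ} (hμ : μ ≠ 0) (a : ℕ) :
    ((sh C μ) ^ a)ᵀ * A = (-μ) ^ a • (A * (D ^ a * sh C μ⁻¹ ^ a)) := by
  induction a with
  | zero => simp
  | succ a ih =>
    rw [pow_succ', Matrix.transpose_mul, Matrix.mul_assoc, h.adj1 hμ, mul_smul_comm,
      Matrix.mul_assoc A D, ← Matrix.mul_assoc, ih, smul_mul_assoc, smul_smul, ← pow_succ']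
    congr 1
    rw [Matrix.mul_assoc]
    congr 1
    rw [pow_succ, pow_succ]
    have := ((h.commD μ⁻¹).pow_right a).eq
    calc D ^ a * sh C μ⁻¹ ^ a * (D * sh C μ⁻¹) = D ^ a * (sh C μ⁻¹ ^ a * D) * sh C μ⁻¹ := by
          noncomm_ring
      _ = D ^ a * D * (sh C μ⁻¹ ^ a * sh C μ⁻¹) := by rw [← this]; noncomm_ring

theorem Cosq.pair {A C D : Matrix (Fin n) (Fin n) ℂ} (h : Cosq A C D) {μ : ℂ} (hμ : μ ≠ 0) (a b : ℕ)
    (x y : Fin n → ℂ) : bil A (sh C μ ^ a *ᵥ x) (sh C μ⁻¹ ^ b *ᵥ y) =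
      (-μ) ^ a * bil A x (D ^ a *ᵥ (sh C μ⁻¹ ^ (a + b) *ᵥ y)) := by
  rw [bil_mul_left, h.adj hμ, bil_smul_mat, pow_add, ← Matrix.mulVec_mulVec, ← bil_mul_right,
    ← Matrix.mulVec_mulVec]

theorem pow_zero_of_le {F : Matrix (Fin n) (Fin n) ℂ} {y : Fin n → ℂ} {k s : ℕ} (hy : F ^ k *ᵥ y = 0)
    (h : k ≤ s) : F ^ s *ᵥ y = 0 := by
  obtain ⟨t, rfl⟩ := Nat.exists_eq_add_of_le h
  rw [add_comm, pow_add, ← Matrix.mulVec_mulVec, hy, Matrix.mulVec_zero]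

theorem Cosq.pair0 {A C D : Matrix (Fin n) (Fin n) ℂ} (h : Cosq A C D) {μ : ℂ} (hμ : μ ≠ 0)
    {a b k : ℕ} (x : Fin n → ℂ) {y : Fin n → ℂ} (hy : sh C μ⁻¹ ^ k *ᵥ y = 0) (hk : k ≤ a + b) :
    bil A (sh C μ ^ a *ᵥ x) (sh C μ⁻¹ ^ b *ᵥ y) = 0 := by
  rw [h.pair hμ, pow_zero_of_le hy hk, Matrix.mulVec_zero, bil_zero_right, mul_zero]

theorem Cosq.pair1 {A C D : Matrix (Fin n) (Fin n) ℂ} (h : Cosq A C D) {μ : ℂ} (hμ : μ ≠ 0)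
    {a b k : ℕ} (x : Fin n → ℂ) {y : Fin n → ℂ} (hy : sh C μ⁻¹ ^ k *ᵥ y = 0) (hk : k = a + b + 1) :
    bil A (sh C μ ^ a *ᵥ x) (sh C μ⁻¹ ^ b *ᵥ y) =
      (-(μ * μ)) ^ a * bil A x (sh C μ⁻¹ ^ (k - 1) *ᵥ y) := by
  have hw : C *ᵥ (sh C μ⁻¹ ^ (k - 1) *ᵥ y) = μ⁻¹ • (sh C μ⁻¹ ^ (k - 1) *ᵥ y) := by
    rw [sh_mulVec C μ⁻¹, Matrix.mulVec_mulVec _ (sh C μ⁻¹), ← pow_succ',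
      show k - 1 + 1 = k by omega, hy, add_zero]
  have hw2 : D *ᵥ (sh C μ⁻¹ ^ (k - 1) *ᵥ y) = μ • (sh C μ⁻¹ ^ (k - 1) *ᵥ y) := by
    have := congrArg (fun v => μ • (D *ᵥ v)) hw
    rw [Matrix.mulVec_mulVec _ D C, h.hDC, Matrix.one_mulVec, Matrix.mulVec_smul, smul_smul,
      mul_inv_cancel₀ hμ, one_smul] at this
    exact this.symm
  have hw3 : ∀ s, D ^ s *ᵥ (sh C μ⁻¹ ^ (k - 1) *ᵥ y) = μ ^ s • (sh C μ⁻¹ ^ (k - 1) *ᵥ y) := by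
    intro s
    induction s with
    | zero => simp
    | succ s ih => rw [pow_succ', ← Matrix.mulVec_mulVec, ih, Matrix.mulVec_smul, hw2, smul_smul,
        pow_succ]
  rw [h.pair hμ, show a + b = k - 1 by omega, hw3, bil_smul_right, ← mul_assoc, ← mul_pow]
  congr 2; ring

theorem Cosq.isotropic {A C D : Matrix (Fin n) (Fin n) ℂ} (h : Cosq A C D) {μ : ℂ} (hμ : μ * μ ≠ 1)
    (s : ℕ) : ∀ a b : ℕ, a + b = s → ∀ x y : Fin n → ℂ, sh C μ ^ a *ᵥ x = 0 → sh C μ ^ b *ᵥ y = 0 →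
      bil A x y = 0 := by
  induction s using Nat.strong_induction_on with
  | _ s ih =>
  intro a b hab x y hx hy
  rcases Nat.eq_zero_or_pos a with rfl | ha
  · rw [pow_zero, Matrix.one_mulVec] at hx; rw [hx, bil_zero_left]
  rcases Nat.eq_zero_or_pos b with rfl | hb
  · rw [pow_zero, Matrix.one_mulVec] at hy; rw [hy, bil_zero_right]
  have hx' : sh C μ ^ (a - 1) *ᵥ (sh C μ *ᵥ x) = 0 := by
    rw [Matrix.mulVec_mulVec, ← pow_succ, show a - 1 + 1 = a by omega, hx]
  have hy' : sh C μ ^ (b - 1) *ᵥ (sh C μ *ᵥ y) = 0 := by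
    rw [Matrix.mulVec_mulVec, ← pow_succ, show b - 1 + 1 = b by omega, hy]
  have e := h.inv x y
  rw [sh_mulVec C μ x, sh_mulVec C μ y] at e
  simp only [bil_add_left, bil_add_right, bil_smul_left, bil_smul_right] at e
  rw [ih (a - 1 + b) (by omega) (a - 1) b rfl _ y hx' hy,
    ih (a + (b - 1)) (by omega) a (b - 1) rfl x _ hx hy',
    ih (a - 1 + (b - 1)) (by omega) (a - 1) (b - 1) rfl _ _ hx' hy'] at e
  have : (μ * μ - 1) * bil A x y = 0 := by linear_combination e
  exact (mul_eq_zero.1 this).resolve_left (sub_ne_zero.2 hμ)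

/-- Fitting decomposition for a matrix. -/
theorem fitting (F G : Matrix (Fin n) (Fin n) ℂ) : ∃ N : ℕ, 1 ≤ N ∧
    (∀ v, ∃ u w, v = u + F ^ N *ᵥ w ∧ F ^ N *ᵥ u = 0) ∧
    (∀ v, ∃ u w, v = u + G ^ N *ᵥ w ∧ G ^ N *ᵥ u = 0) := by
  have h1 := LinearMap.eventually_isCompl_ker_pow_range_pow (Matrix.toLin' F)
  have h2 := LinearMap.eventually_isCompl_ker_pow_range_pow (Matrix.toLin' G)
  obtain ⟨N, ⟨hN1, hN2⟩, hN0⟩ := ((h1.and h2).and (Filter.eventually_ge_atTop 1)).exists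
  have key : ∀ H : Matrix (Fin n) (Fin n) ℂ, IsCompl (LinearMap.ker (Matrix.toLin' H ^ N))
      (LinearMap.range (Matrix.toLin' H ^ N)) → ∀ v, ∃ u w, v = u + H ^ N *ᵥ w ∧ H ^ N *ᵥ u = 0 := by
    intro H hH v
    rw [← Matrix.toLin'_pow] at hH
    have : v ∈ LinearMap.ker (Matrix.toLin' (H ^ N)) ⊔ LinearMap.range (Matrix.toLin' (H ^ N)) := by
      rw [hH.sup_eq_top]; trivial
    obtain ⟨u, hu, w, ⟨z, rfl⟩, rfl⟩ := Submodule.mem_sup.1 this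
    exact ⟨u, z, by rw [Matrix.toLin'_apply], by rw [← Matrix.toLin'_apply]; exact hu⟩
  exact ⟨N, hN0, key F hN1, key G hN2⟩

theorem gram_apply {κ : Type*} (A : Matrix (Fin n) (Fin n) ℂ) (E : Matrix (Fin n) κ ℂ) (i j : κ) :
    (Eᵀ * A * E) i j = bil A (fun a => E a i) (fun a => E a j) := by
  rw [Matrix.mul_assoc, Matrix.mul_apply]
  rfl

theorem neg_sq_pow {μ : ℂ} (h : μ ≠ 0) (a : ℕ) : (-(μ * μ)) ^ a ≠ 0 :=
  pow_ne_zero _ (neg_ne_zero.2 (mul_ne_zero h h))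

theorem split_Gamma {A C D : Matrix (Fin n) (Fin n) ℂ} (h : Cosq A C D) {μ : ℂ} (hμ : μ * μ = 1)
    {k : ℕ} (hk : 1 ≤ k) (x : Fin n → ℂ) (hx : sh C μ ^ k *ᵥ x = 0)
    (hne : bil A x (sh C μ ^ (k - 1) *ᵥ x) ≠ 0) :
    ∃ (d : ℕ) (A' : Matrix (Fin d) (Fin d) ℂ), Cong A (Matrix.fromBlocks (Gamma k) 0 0 A') := by
  have hμ0 : μ ≠ 0 := by rintro rfl; simp at hμ
  have hinv : μ⁻¹ = μ := inv_eq_of_mul_eq_one_left hμ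
  have hx2 : sh C μ⁻¹ ^ k *ᵥ x = 0 := by rw [hinv, hx]
  have p0 : ∀ a b, k ≤ a + b → bil A (sh C μ ^ a *ᵥ x) (sh C μ ^ b *ᵥ x) = 0 := by
    intro a b hab
    have := h.pair0 hμ0 x hx2 hab
    rwa [hinv] at this
  have p1 : ∀ a b, k = a + b + 1 → bil A (sh C μ ^ a *ᵥ x) (sh C μ ^ b *ᵥ x) =
      (-(μ * μ)) ^ a * bil A x (sh C μ ^ (k - 1) *ᵥ x) := by
    intro a b hab
    have := h.pair1 hμ0 x hx2 hab
    rwa [hinv] at this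
  have hμk : μ = (-1) ^ (k + 1) := by
    have e1 := p1 (k - 1) 0 (by omega)
    rw [pow_zero, Matrix.one_mulVec] at e1
    rw [← h.flip x, sh_mulVec C μ x, bil_add_left, bil_smul_left] at e1
    have e2 := p0 1 (k - 1) (by omega)
    rw [pow_one] at e2
    rw [e2, add_zero] at e1
    have e3 := mul_right_cancel₀ hne e1
    rw [hμ] at e3
    rw [e3, show k + 1 = (k - 1) + 2 by omega, pow_add]; simp
  subst hμk
  set μ : ℂ := (-1) ^ (k + 1)
  have hu : IsUnit ((chainM C μ k x)ᵀ * A * chainM C μ k x) := by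
    refine isUnit_of_level _ (Fin.rev : Fin k → Fin k) (fun j : Fin k => k - (j : ℕ)) ?_ ?_
    · intro i
      rw [gram_apply]
      have : bil A (sh C μ ^ (k - 1 - (Fin.rev i : ℕ)) *ᵥ x) (sh C μ ^ (k - 1 - (i : ℕ)) *ᵥ x) ≠ 0 := by
        rw [p1 _ _ (by rw [Fin.val_rev]; omega)]
        exact mul_ne_zero (neg_sq_pow hμ0 _) hne
      exact this
    · intro i j hj hl
      have : (j : ℕ) ≠ i := fun h => hj (Fin.ext h)
      rw [gram_apply]
      exact p0 (k - 1 - (Fin.rev i : ℕ)) (k - 1 - (j : ℕ)) (by rw [Fin.val_rev]; omega)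
  refine split_lemma A (Gamma k) _ _ (se_Gamma hk) (chainM C μ k x) ((chainM C μ k x)ᵀ * A) ?_ ?_ hu
  · rw [Matrix.transpose_mul, Matrix.transpose_transpose, Matrix.mul_assoc,
      ← mul_chainM C μ k x hx, ← Matrix.mul_assoc, h.hC]
  · rw [Matrix.transpose_mul, Matrix.transpose_transpose, Matrix.mul_one]

theorem split_H {A C D : Matrix (Fin n) (Fin n) ℂ} (h : Cosq A C D) {μ : ℂ} (hμ0 : μ ≠ 0)
    {k : ℕ} (hk : 1 ≤ k) (x y : Fin n → ℂ) (hx : sh C μ ^ k *ᵥ x = 0) (hy : sh C μ⁻¹ ^ k *ᵥ y = 0)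
    (hne : bil A (sh C μ ^ (k - 1) *ᵥ x) y ≠ 0)
    (hxx : ∀ a b, k ≤ a + b + 1 → bil A (sh C μ ^ a *ᵥ x) (sh C μ ^ b *ᵥ x) = 0)
    (hyy : ∀ a b, k ≤ a + b + 1 → bil A (sh C μ⁻¹ ^ a *ᵥ y) (sh C μ⁻¹ ^ b *ᵥ y) = 0) :
    ∃ (d : ℕ) (A' : Matrix (Fin d) (Fin d) ℂ), Cong A
      (Matrix.fromBlocks (Matrix.fromBlocks 0 1 (Jblock k μ) 0) 0 0 A') := by
  have hν0 : μ⁻¹ ≠ 0 := inv_ne_zero hμ0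
  have hx2 : sh C μ⁻¹⁻¹ ^ k *ᵥ x = 0 := by rw [inv_inv, hx]
  have xy0 : ∀ a b, k ≤ a + b → bil A (sh C μ ^ a *ᵥ x) (sh C μ⁻¹ ^ b *ᵥ y) = 0 :=
    fun a b hab => h.pair0 hμ0 x hy hab
  have yx0 : ∀ a b, k ≤ a + b → bil A (sh C μ⁻¹ ^ a *ᵥ y) (sh C μ ^ b *ᵥ x) = 0 := by
    intro a b hab
    have := h.pair0 hν0 y hx2 hab
    rwa [inv_inv] at this
  have hne1 : bil A x (sh C μ⁻¹ ^ (k - 1) *ᵥ y) ≠ 0 := by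
    have := h.pair1 hμ0 (a := k - 1) (b := 0) x hy (by omega)
    rw [pow_zero, Matrix.one_mulVec] at this
    intro h0
    rw [h0, mul_zero] at this
    exact hne this
  have hne2 : bil A y (sh C μ ^ (k - 1) *ᵥ x) ≠ 0 := by
    rw [← h.flip, sh_mulVec C μ, Matrix.mulVec_mulVec, ← pow_succ', show k - 1 + 1 = k by omega, hx,
      add_zero, bil_smul_left]
    exact mul_ne_zero hμ0 hne
  have xy1 : ∀ a b, k = a + b + 1 → bil A (sh C μ ^ a *ᵥ x) (sh C μ⁻¹ ^ b *ᵥ y) ≠ 0 := by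
    intro a b hab
    rw [h.pair1 hμ0 x hy hab]
    exact mul_ne_zero (neg_sq_pow hμ0 _) hne1
  have yx1 : ∀ a b, k = a + b + 1 → bil A (sh C μ⁻¹ ^ a *ᵥ y) (sh C μ ^ b *ᵥ x) ≠ 0 := by
    intro a b hab
    have := h.pair1 hν0 y hx2 hab
    rw [inv_inv] at this
    rw [this]
    exact mul_ne_zero (neg_sq_pow hν0 _) hne2
  set E : Matrix (Fin n) (Fin k ⊕ Fin k) ℂ := Matrix.fromCols (chainM C μ k x) (chainM C μ⁻¹ k y) with hE
  have hu : IsUnit (Eᵀ * A * E) := by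
    refine isUnit_of_level _ (Sum.elim (fun j => Sum.inr (Fin.rev j)) (fun j => Sum.inl (Fin.rev j)) :
      Fin k ⊕ Fin k → Fin k ⊕ Fin k) (Sum.elim (fun j => k - (j : ℕ)) (fun j => k - (j : ℕ))) ?_ ?_
    · rintro (i | i)
      · rw [gram_apply]
        exact yx1 (k - 1 - (Fin.rev i : ℕ)) (k - 1 - (i : ℕ)) (by rw [Fin.val_rev]; omega)
      · rw [gram_apply]
        exact xy1 (k - 1 - (Fin.rev i : ℕ)) (k - 1 - (i : ℕ)) (by rw [Fin.val_rev]; omega)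
    · rintro (i | i) (j | j) hj hl
      · have : (j : ℕ) ≠ i := fun h => hj (by rw [Fin.ext h])
        simp only [Sum.elim_inl, Sum.elim_inr] at hl
        rw [gram_apply]
        exact yx0 (k - 1 - (Fin.rev i : ℕ)) (k - 1 - (j : ℕ)) (by rw [Fin.val_rev]; omega)
      · simp only [Sum.elim_inl, Sum.elim_inr] at hl
        rw [gram_apply]
        exact hyy (k - 1 - (Fin.rev i : ℕ)) (k - 1 - (j : ℕ)) (by rw [Fin.val_rev]; omega)
      · simp only [Sum.elim_inl, Sum.elim_inr] at hl
        rw [gram_apply]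
        exact hxx (k - 1 - (Fin.rev i : ℕ)) (k - 1 - (j : ℕ)) (by rw [Fin.val_rev]; omega)
      · have : (j : ℕ) ≠ i := fun h => hj (by rw [Fin.ext h])
        simp only [Sum.elim_inl, Sum.elim_inr] at hl
        rw [gram_apply]
        exact xy0 (k - 1 - (Fin.rev i : ℕ)) (k - 1 - (j : ℕ)) (by rw [Fin.val_rev]; omega)
  have hCE : C * E = E * Matrix.fromBlocks (Jblock k μ) 0 0 (Jblock k μ⁻¹) := by
    rw [hE, Matrix.fromCols_mul_fromBlocks, Matrix.mul_fromCols, mul_chainM C μ k x hx,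
      mul_chainM C μ⁻¹ k y hy]
    simp
  refine split_lemma A _ _ _ (se_H hk hμ0) E (Eᵀ * A) ?_ ?_ hu
  · rw [Matrix.transpose_mul, Matrix.transpose_transpose, Matrix.mul_assoc,
      ← hCE, ← Matrix.mul_assoc, h.hC]
  · rw [Matrix.transpose_mul, Matrix.transpose_transpose, Matrix.mul_one]

theorem nonsing_split (hn : 0 < n) (A : Matrix (Fin n) (Fin n) ℂ) (hA : IsUnit A) :
    ∃ (k : ℕ) (_ : 1 ≤ k) (d : ℕ) (A' : Matrix (Fin d) (Fin d) ℂ),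
      Cong A (Matrix.fromBlocks (Gamma k) 0 0 A') ∨ ∃ μ : ℂ, μ ≠ 0 ∧ μ ≠ (-1) ^ (k + 1) ∧
        Cong A (Matrix.fromBlocks (Matrix.fromBlocks 0 1 (Jblock k μ) 0) 0 0 A') := by
  obtain ⟨a1, a2⟩ := isUnit_inv_pair hA
  obtain ⟨t1, t2⟩ := isUnit_inv_pair ((Matrix.isUnit_transpose _).2 hA)
  obtain ⟨C, D, h⟩ : ∃ C D, Cosq A C D := by
    refine ⟨Aᵀ⁻¹ * A, A⁻¹ * Aᵀ, ?_, ?_, ?_⟩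
    · rw [← Matrix.mul_assoc, t1, Matrix.one_mul]
    · rw [Matrix.mul_assoc, ← Matrix.mul_assoc A, a1, Matrix.one_mul, t2]
    · rw [Matrix.mul_assoc, ← Matrix.mul_assoc Aᵀ, t1, Matrix.one_mul, a2]
  have hnd : ∀ y, (∀ x, bil A x y = 0) → y = 0 := by
    intro y hy
    have h1 : A *ᵥ y = 0 := by
      ext i
      have := hy (Pi.single i 1)
      rw [bil, single_one_dotProduct] at this
      exact this
    have := congrArg (fun v => A⁻¹ *ᵥ v) h1
    simpa [Matrix.mulVec_mulVec, a2] using this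
  have hnd2 : ∀ x, (∀ y, bil A x y = 0) → x = 0 := by
    intro x hx
    have h1 : C *ᵥ x = 0 ∨ x = 0 := by
      right
      apply hnd
      intro y
      rw [← h.flip]
      have := hx (D *ᵥ y)
      rw [← h.inv, Matrix.mulVec_mulVec, h.hCD, Matrix.one_mulVec] at this
      exact this
    rcases h1 with h1 | h1
    · have := congrArg (fun v => D *ᵥ v) h1
      simpa [Matrix.mulVec_mulVec, h.hDC] using this
    · exact h1
  haveI : Nonempty (Fin n) := ⟨⟨0, hn⟩⟩
  obtain ⟨μ, hμe⟩ := Module.End.exists_eigenvalue (Matrix.toLin' C)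
  obtain ⟨v, hv⟩ := hμe.exists_hasEigenvector
  have hv0 : v ≠ 0 := hv.2
  have hCv : C *ᵥ v = μ • v := by rw [← Matrix.toLin'_apply]; exact hv.apply_eq_smul
  have hμ0 : μ ≠ 0 := by
    rintro rfl
    rw [zero_smul] at hCv
    have := congrArg (fun v => D *ᵥ v) hCv
    simp [Matrix.mulVec_mulVec, h.hDC] at this
    exact hv0 this
  have hfv : sh C μ *ᵥ v = 0 := by
    have := sh_mulVec C μ v
    rw [hCv] at this
    exact left_eq_add.1 this
  obtain ⟨N, hNpos, hN1, hN2⟩ := fitting (sh C μ) (sh C μ⁻¹)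
  -- minimal nilpotency index
  have hex : ∃ k, ∀ w, sh C μ ^ N *ᵥ w = 0 → sh C μ ^ k *ᵥ w = 0 := ⟨N, fun w hw => hw⟩
  classical
  set k := Nat.find hex with hkdef
  have hkspec := Nat.find_spec hex
  rw [← hkdef] at hkspec
  have hkmin : ∀ m, m < k → ¬ ∀ w, sh C μ ^ N *ᵥ w = 0 → sh C μ ^ m *ᵥ w = 0 :=
    fun m hm => Nat.find_min hex hm
  have hk : 1 ≤ k := by
    by_contra hk0
    have hk0 : k = 0 := by omega
    have hN0 : sh C μ ^ N *ᵥ v = 0 := pow_zero_of_le (k := 1) (by rw [pow_one, hfv]) hNpos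
    have := hkspec v hN0
    rw [hk0, pow_zero, Matrix.one_mulVec] at this
    exact hv0 this
  -- orthogonality
  have horth : ∀ u z m, sh C μ ^ m *ᵥ u = 0 → bil A u (sh C μ⁻¹ ^ m *ᵥ z) = 0 := by
    intro u z m hu
    have e := h.pair hμ0 m 0 u (C ^ m *ᵥ z)
    rw [hu, bil_zero_left, add_zero] at e
    have hcm : Commute C D := by show C * D = D * C; rw [h.hCD, h.hDC]
    rw [Matrix.mulVec_mulVec, Matrix.mulVec_mulVec, ((h.commD μ⁻¹).pow_pow m m).eq, Matrix.mul_assoc,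
      ← hcm.symm.mul_pow, h.hDC, one_pow, Matrix.mul_one] at e
    exact (mul_eq_zero.1 e.symm).resolve_left (pow_ne_zero _ (neg_ne_zero.2 hμ0))
  have hgk : ∀ y, sh C μ⁻¹ ^ N *ᵥ y = 0 → sh C μ⁻¹ ^ k *ᵥ y = 0 := by
    intro y hy
    apply hnd
    intro x
    obtain ⟨u, w, rfl, hu⟩ := hN1 x
    rw [bil_add_left, horth u y k (hkspec u hu), zero_add]
    exact h.pair0 hμ0 w hy (by omega)
  by_cases hcase : μ * μ = 1 ∧ ∃ x, sh C μ ^ k *ᵥ x = 0 ∧ bil A x (sh C μ ^ (k - 1) *ᵥ x) ≠ 0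
  · obtain ⟨hμ2, x, hx, hne⟩ := hcase
    obtain ⟨d, A', hA'⟩ := split_Gamma h hμ2 hk x hx hne
    exact ⟨k, hk, d, A', Or.inl hA'⟩
  have hx := hkmin (k - 1) (by omega)
  push Not at hx hcase
  obtain ⟨x, hxN, hx1⟩ := hx
  have hxk := hkspec x hxN
  obtain ⟨y, hy, hne⟩ : ∃ y, sh C μ⁻¹ ^ N *ᵥ y = 0 ∧ bil A (sh C μ ^ (k - 1) *ᵥ x) y ≠ 0 := by
    by_contra hcon
    push Not at hcon
    apply hx1
    apply hnd2
    intro y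
    obtain ⟨u, w, rfl, hu⟩ := hN2 y
    rw [bil_add_right, hcon u hu, zero_add]
    apply horth
    rw [Matrix.mulVec_mulVec, ← pow_add, add_comm, pow_add, ← Matrix.mulVec_mulVec, hxN,
      Matrix.mulVec_zero]
  have hyk := hgk y hy
  -- isotropy
  have hxx : ∀ a b, k ≤ a + b + 1 → bil A (sh C μ ^ a *ᵥ x) (sh C μ ^ b *ᵥ x) = 0 := by
    intro a b hab
    by_cases hμ2 : μ * μ = 1
    · have hinv : μ⁻¹ = μ := inv_eq_of_mul_eq_one_left hμ2
      have hx2 : sh C μ⁻¹ ^ k *ᵥ x = 0 := by rw [hinv, hxk]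
      by_cases hab' : k = a + b + 1
      · have := h.pair1 hμ0 x hx2 hab'
        rw [hinv, hcase hμ2 x hxk, mul_zero] at this
        exact this
      · have := h.pair0 hμ0 (a := a) (b := b) x hx2 (by omega)
        rwa [hinv] at this
    · apply h.isotropic hμ2 (k + k) k k rfl
      · rw [Matrix.mulVec_mulVec, ← pow_add]; exact pow_zero_of_le hxk (by omega)
      · rw [Matrix.mulVec_mulVec, ← pow_add]; exact pow_zero_of_le hxk (by omega)
  have hyy : ∀ a b, k ≤ a + b + 1 → bil A (sh C μ⁻¹ ^ a *ᵥ y) (sh C μ⁻¹ ^ b *ᵥ y) = 0 := by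
    intro a b hab
    by_cases hμ2 : μ * μ = 1
    · have hinv : μ⁻¹ = μ := inv_eq_of_mul_eq_one_left hμ2
      rw [hinv] at hyk
      rw [hinv]
      have hy2 : sh C μ⁻¹ ^ k *ᵥ y = 0 := by rw [hinv, hyk]
      by_cases hab' : k = a + b + 1
      · have := h.pair1 hμ0 y hy2 hab'
        rw [hinv, hcase hμ2 y hyk, mul_zero] at this
        exact this
      · have := h.pair0 hμ0 (a := a) (b := b) y hy2 (by omega)
        rwa [hinv] at this
    · have hν2 : μ⁻¹ * μ⁻¹ ≠ 1 := by
        rw [← mul_inv]; intro h1; exact hμ2 (inv_eq_one.1 h1)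
      apply h.isotropic hν2 (k + k) k k rfl
      · rw [Matrix.mulVec_mulVec, ← pow_add]; exact pow_zero_of_le hyk (by omega)
      · rw [Matrix.mulVec_mulVec, ← pow_add]; exact pow_zero_of_le hyk (by omega)
  have hμk : μ ≠ (-1) ^ (k + 1) := by
    intro hμk
    have hμ2 : μ * μ = 1 := by rw [hμk, ← mul_pow]; simp
    have hinv : μ⁻¹ = μ := inv_eq_of_mul_eq_one_left hμ2
    rw [hinv] at hyk
    have p1 : ∀ u w, sh C μ ^ k *ᵥ w = 0 → bil A (sh C μ ^ (k - 1) *ᵥ u) w =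
        (-1) ^ (k - 1) * bil A u (sh C μ ^ (k - 1) *ᵥ w) := by
      intro u w hw
      have := h.pair1 hμ0 (a := k - 1) (b := 0) (k := k) (y := w) u (by rw [hinv, hw]) (by omega)
      rwa [hinv, hμ2, pow_zero, Matrix.one_mulVec] at this
    have hsym : ∀ u w, sh C μ ^ k *ᵥ u = 0 → sh C μ ^ k *ᵥ w = 0 →
        bil A w (sh C μ ^ (k - 1) *ᵥ u) = bil A u (sh C μ ^ (k - 1) *ᵥ w) := by
      intro u w hu hw
      have e1 := p1 w u hu
      rw [← h.flip u, sh_mulVec C μ u, bil_add_left, bil_smul_left] at e1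
      have e2 := h.pair0 hμ0 (a := 1) (b := k - 1) (k := k) (y := w) u (by rw [hinv, hw]) (by omega)
      rw [hinv, pow_one] at e2
      have hs : ((-1 : ℂ) ^ (k - 1)) = μ := by
        rw [hμk, show k + 1 = (k - 1) + 2 by omega, pow_add]; simp
      rw [e2, add_zero, hs] at e1
      exact (mul_left_cancel₀ hμ0 e1).symm
    have e := hcase hμ2 (x + y) (by rw [Matrix.mulVec_add, hxk, hyk, add_zero])
    rw [Matrix.mulVec_add, bil_add_left, bil_add_right, bil_add_right, hcase hμ2 x hxk,
      hcase hμ2 y hyk, hsym x y hxk hyk, zero_add, add_zero] at e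
    have e2 : bil A x (sh C μ ^ (k - 1) *ᵥ y) = 0 := by linear_combination e / 2
    exact hne (by rw [p1 x y hyk, e2, mul_zero])
  obtain ⟨d, A', hA'⟩ := split_H h hμ0 hk x y hxk hyk hne hxx hyy
  exact ⟨k, hk, d, A', Or.inr ⟨μ, hμ0, hμk, hA'⟩⟩

end nonsing

end part5

section part6

theorem cong_refl {n : ℕ} (A : Matrix (Fin n) (Fin n) ℂ) : Cong A A :=
  ⟨1, 1, by simp, by simp, by simp⟩

theorem block_split {n : ℕ} (hn : 0 < n) (A : Matrix (Fin n) (Fin n) ℂ) :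
    ∃ (b : CBlock) (_ : b.Valid) (_ : 1 ≤ b.size) (d : ℕ) (A' : Matrix (Fin d) (Fin d) ℂ),
      Cong A (Matrix.fromBlocks b.mat 0 0 A') := by
  by_cases hA : IsUnit A
  · obtain ⟨k, hk, d, A', h | ⟨μ, hμ, hμk, h⟩⟩ := nonsing_split hn A hA
    · exact ⟨.typeI k, hk, hk, d, A', h⟩
    · refine ⟨.typeII k μ, ⟨hk, hμ, hμk⟩, by simp only [CBlock.size]; omega, d, A', h.trans' ?_⟩
      exact cong_fromBlocks (cong_reindex finSumFinEquiv _) (cong_refl A')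
  · obtain ⟨k, hk, d, A', h⟩ := sing_split A hA
    exact ⟨.type0 k, hk, hk, d, A', h⟩

theorem existence_cong (n : ℕ) : ∀ A : Matrix (Fin n) (Fin n) ℂ, ∃ L : List CBlock,
    (∀ b ∈ L, b.Valid) ∧ Cong A (blocksMat L) := by
  induction n using Nat.strong_induction_on with
  | _ n ih =>
  intro A
  rcases Nat.eq_zero_or_pos n with rfl | hn
  · refine ⟨[], by simp, 0, 0, ?_, ?_, ?_⟩
    · ext i; exact i.elim0
    · ext i; exact Fin.elim0 i
    · ext i; exact i.elim0
  · obtain ⟨b, hb, hs, d, A', h⟩ := block_split hn A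
    have hc := h.card_eq
    simp only [Fintype.card_sum, Fintype.card_fin] at hc
    obtain ⟨L, hL, hL'⟩ := ih d (by omega) A'
    refine ⟨b :: L, ?_, ?_⟩
    · intro b' hb'
      rcases List.mem_cons.1 hb' with rfl | h'
      · exact hb
      · exact hL b' h'
    · exact h.trans' ((cong_fromBlocks (cong_refl b.mat) hL').trans' (cong_reindex finSumFinEquiv _))

theorem existence_part (n : ℕ) (A : Matrix (Fin n) (Fin n) ℂ) :
    ∃ (L : List CBlock) (h : blocksSize L = n),
      (∀ b ∈ L, b.Valid) ∧
      ∃ P : Matrix (Fin n) (Fin n) ℂ, IsUnit P ∧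
        A = P * Matrix.reindex (finCongr h) (finCongr h) (blocksMat L) * Pᵀ := by
  obtain ⟨L, hL, h⟩ := existence_cong n A
  have hc := h.card_eq
  simp only [Fintype.card_fin] at hc
  refine ⟨L, hc.symm, hL, ?_⟩
  obtain ⟨P, P', h1, h2, h3⟩ := h.trans' (cong_reindex (finCongr hc.symm) _)
  exact ⟨P, IsUnit.of_mul_eq_one P' h1, h3⟩

theorem cong_of_part {n : ℕ} (A : Matrix (Fin n) (Fin n) ℂ) (L : List CBlock) (h : blocksSize L = n)
    (hP : ∃ P : Matrix (Fin n) (Fin n) ℂ, IsUnit P ∧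
        A = P * Matrix.reindex (finCongr h) (finCongr h) (blocksMat L) * Pᵀ) :
    Cong A (blocksMat L) := by
  obtain ⟨P, hP, hA⟩ := hP
  obtain ⟨p1, p2⟩ := isUnit_inv_pair hP
  have h1 : Cong A (Matrix.reindex (finCongr h) (finCongr h) (blocksMat L)) := ⟨P, P⁻¹, p1, p2, hA⟩
  exact h1.trans' (cong_reindex (finCongr h) _).symm'

end part6

section part7

section solspace

variable {V : Type} [AddCommGroup V] [Module ℂ V]
variable {ι κ τ : Type} [Fintype ι] [Fintype κ] [Fintype τ]
  [DecidableEq ι] [DecidableEq κ] [DecidableEq τ]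

/-- Action of a matrix on vectors with entries in a vector space. -/
def act (S : Matrix ι κ ℂ) : (κ → V) →ₗ[ℂ] (ι → V) where
  toFun x := fun i => ∑ j, S i j • x j
  map_add' x y := by ext i; simp [Finset.sum_add_distrib]
  map_smul' c x := by
    ext i
    simp only [Pi.smul_apply, RingHom.id_apply, Finset.smul_sum]
    exact Finset.sum_congr rfl fun j _ => smul_comm _ _ _

theorem act_apply (S : Matrix ι κ ℂ) (x : κ → V) (i : ι) : act S x i = ∑ j, S i j • x j := rfl

theorem act_mul (S : Matrix ι κ ℂ) (T : Matrix κ τ ℂ) (x : τ → V) : act (S * T) x = act S (act T x) := by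
  ext i
  simp only [act_apply, Matrix.mul_apply, Finset.sum_smul, Finset.smul_sum, smul_smul]
  rw [Finset.sum_comm]

theorem act_one (x : ι → V) : act (1 : Matrix ι ι ℂ) x = x := by
  ext i
  simp [act_apply, Matrix.one_apply]

theorem act_comp (θ : V →ₗ[ℂ] V) (S : Matrix ι κ ℂ) (x : κ → V) :
    act S (fun j => θ (x j)) = fun i => θ (act S x i) := by
  ext i
  simp [act_apply]

/-- Solutions, in a subspace `U`, of `K₀ x = K₁ θ x`. -/
def Sol (θ : V →ₗ[ℂ] V) (U : Submodule ℂ V) (K₀ K₁ : Matrix ι ι ℂ) : Submodule ℂ (ι → V) where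
  carrier := {x | (∀ i, x i ∈ U) ∧ act K₀ x = act K₁ (fun i => θ (x i))}
  add_mem' := by
    rintro x y ⟨hx, hx'⟩ ⟨hy, hy'⟩
    refine ⟨fun i => U.add_mem (hx i) (hy i), ?_⟩
    have : (fun i => θ ((x + y) i)) = (fun i => θ (x i)) + fun i => θ (y i) := by ext i; simp
    rw [this, map_add, map_add, hx', hy']
  zero_mem' := by
    refine ⟨fun i => U.zero_mem, ?_⟩
    have : (fun i => θ ((0 : ι → V) i)) = 0 := by ext i; simp
    rw [this, map_zero, map_zero]
  smul_mem' := by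
    rintro c x ⟨hx, hx'⟩
    refine ⟨fun i => U.smul_mem c (hx i), ?_⟩
    have : (fun i => θ ((c • x) i)) = c • (fun i => θ (x i)) := by ext i; simp
    rw [this, map_smul, map_smul, hx']

theorem mem_Sol {θ : V →ₗ[ℂ] V} {U : Submodule ℂ V} {K₀ K₁ : Matrix ι ι ℂ} {x : ι → V} :
    x ∈ Sol θ U K₀ K₁ ↔ (∀ i, x i ∈ U) ∧ act K₀ x = act K₁ (fun i => θ (x i)) := Iff.rfl

instance Sol_fin (θ : V →ₗ[ℂ] V) (U : Submodule ℂ V) [FiniteDimensional ℂ U] (K₀ K₁ : Matrix ι ι ℂ) :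
    FiniteDimensional ℂ (Sol θ U K₀ K₁) := by
  let f : Sol θ U K₀ K₁ →ₗ[ℂ] (ι → U) :=
    { toFun := fun x i => ⟨x.1 i, x.2.1 i⟩
      map_add' := fun x y => rfl
      map_smul' := fun c x => rfl }
  refine FiniteDimensional.of_injective f ?_
  intro x y h
  ext i
  have := congrFun h i
  exact congrArg Subtype.val this

theorem Sol_le (θ : V →ₗ[ℂ] V) (U : Submodule ℂ V) [FiniteDimensional ℂ U] {A₀ A₁ : Matrix ι ι ℂ}
    {B₀ B₁ : Matrix κ κ ℂ} (h : SE A₀ A₁ B₀ B₁) :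
    Module.finrank ℂ (Sol θ U A₀ A₁) ≤ Module.finrank ℂ (Sol θ U B₀ B₁) := by
  obtain ⟨R, R', S, S', r1, r2, s1, s2, h0, h1⟩ := h
  have hmem : ∀ x ∈ Sol θ U A₀ A₁, act S x ∈ Sol θ U B₀ B₁ := by
    rintro x ⟨hx, hx'⟩
    refine ⟨fun i => U.sum_mem fun j _ => U.smul_mem _ (hx j), ?_⟩
    rw [h0, h1, act_mul, act_mul, act_mul, act_mul] at hx'
    have := congrArg (act R') hx'
    rw [← act_mul R' R, ← act_mul R' R, r2, act_one, act_one, act_comp] at this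
    exact this
  let f : Sol θ U A₀ A₁ →ₗ[ℂ] Sol θ U B₀ B₁ :=
    ((act S).comp (Sol θ U A₀ A₁).subtype).codRestrict _ (fun x => hmem x.1 x.2)
  refine LinearMap.finrank_le_finrank_of_injective (f := f) ?_
  intro x y hxy
  have h2 : act S x.1 = act S y.1 := congrArg Subtype.val hxy
  have h3 := congrArg (act S') h2
  rw [← act_mul, ← act_mul, s2, act_one, act_one] at h3
  exact Subtype.ext h3

theorem Sol_eq (θ : V →ₗ[ℂ] V) (U : Submodule ℂ V) [FiniteDimensional ℂ U] {A₀ A₁ : Matrix ι ι ℂ}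
    {B₀ B₁ : Matrix κ κ ℂ} (h : SE A₀ A₁ B₀ B₁) :
    Module.finrank ℂ (Sol θ U A₀ A₁) = Module.finrank ℂ (Sol θ U B₀ B₁) :=
  le_antisymm (Sol_le θ U h) (Sol_le θ U h.symm')

theorem act_fromBlocks (K : Matrix ι ι ℂ) (K' : Matrix κ κ ℂ) (x : ι ⊕ κ → V) :
    act (Matrix.fromBlocks K 0 0 K') x =
      Sum.elim (act K (fun i => x (Sum.inl i))) (act K' (fun i => x (Sum.inr i))) := by
  ext (i | i) <;> simp [act_apply]

theorem Sol_blocks (θ : V →ₗ[ℂ] V) (U : Submodule ℂ V) [FiniteDimensional ℂ U] (A₀ A₁ : Matrix ι ι ℂ)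
    (B₀ B₁ : Matrix κ κ ℂ) :
    Module.finrank ℂ (Sol θ U (Matrix.fromBlocks A₀ 0 0 B₀) (Matrix.fromBlocks A₁ 0 0 B₁)) =
      Module.finrank ℂ (Sol θ U A₀ A₁) + Module.finrank ℂ (Sol θ U B₀ B₁) := by
  rw [← Module.finrank_prod]
  have hm : ∀ x : ι ⊕ κ → V, x ∈ Sol θ U (Matrix.fromBlocks A₀ 0 0 B₀) (Matrix.fromBlocks A₁ 0 0 B₁) ↔
      ((fun i => x (Sum.inl i)) ∈ Sol θ U A₀ A₁ ∧ (fun i => x (Sum.inr i)) ∈ Sol θ U B₀ B₁) := by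
    intro x
    simp only [mem_Sol, act_fromBlocks, Sum.forall]
    constructor
    · rintro ⟨⟨h1, h2⟩, h3⟩
      exact ⟨⟨h1, funext fun i => congrFun h3 (Sum.inl i)⟩, ⟨h2, funext fun i => congrFun h3 (Sum.inr i)⟩⟩
    · rintro ⟨⟨h1, h2⟩, h3, h4⟩
      exact ⟨⟨h1, h3⟩, by rw [h2, h4]⟩
  exact LinearEquiv.finrank_eq
    { toFun := fun x => (⟨_, ((hm x.1).1 x.2).1⟩, ⟨_, ((hm x.1).1 x.2).2⟩)
      map_add' := fun x y => rfl
      map_smul' := fun c x => rfl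
      invFun := fun p => ⟨Sum.elim p.1.1 p.2.1, (hm _).2 ⟨p.1.2, p.2.2⟩⟩
      left_inv := fun x => by ext (i | i) <;> rfl
      right_inv := fun p => rfl }

theorem act_J {k : ℕ} (ε : ℂ) (x : Fin k → V) (i : Fin k) : act (Jblock k ε) x i =
    ε • x i + if h : (i : ℕ) + 1 < k then x ⟨i + 1, h⟩ else 0 := by
  have hs : ∀ l : Fin k, Jblock k ε i l • x l =
      (if l = i then ε • x l else 0) + (if (l : ℕ) = i + 1 then x l else 0) := by
    intro l
    simp only [Jblock, Matrix.of_apply]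
    by_cases h1 : (l : ℕ) = i
    · have : l = i := Fin.ext h1
      subst this; simp
    · have h2 : l ≠ i := fun h => h1 (by rw [h])
      simp only [h1, h2, if_false, zero_add]
      split_ifs <;> simp
  rw [act_apply, Finset.sum_congr rfl (fun l _ => hs l), Finset.sum_add_distrib]
  congr 1
  · simp
  · split_ifs with h
    · rw [Finset.sum_eq_single ⟨i + 1, h⟩]
      · simp
      · intro b _ hb
        rw [if_neg]
        intro hjb
        exact hb (Fin.ext hjb)
      · simp
    · apply Finset.sum_eq_zero
      intro l _
      rw [if_neg (by omega)]

theorem act_JT {k : ℕ} (x : Fin k → V) (i : Fin k) : act (Jblock k 0)ᵀ x i =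
    if h : 0 < (i : ℕ) then x ⟨i - 1, by omega⟩ else 0 := by
  have hs : ∀ l : Fin k, (Jblock k 0)ᵀ i l • x l =
      (if (i : ℕ) = l + 1 then x l else 0) := by
    intro l
    simp only [Jblock, Matrix.transpose_apply, Matrix.of_apply]
    by_cases h1 : (i : ℕ) = l
    · simp [h1]
    · simp only [h1, if_false]
      split_ifs <;> simp
  rw [act_apply, Finset.sum_congr rfl (fun l _ => hs l)]
  split_ifs with h
  · rw [Finset.sum_eq_single ⟨i - 1, by omega⟩]
    · rw [if_pos]; simp; omega
    · intro b _ hb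
      rw [if_neg]
      intro hjb
      apply hb
      ext; simp; omega
    · simp
  · apply Finset.sum_eq_zero
    intro l _
    rw [if_neg (by omega)]

/-- Compute the dimension by evaluation at the first coordinate. -/
theorem Sol_finrank_eval (θ : V →ₗ[ℂ] V) (U : Submodule ℂ V) (K₀ K₁ : Matrix ι ι ℂ)
    (i₀ : ι) (W : Submodule ℂ V) (h1 : ∀ x ∈ Sol θ U K₀ K₁, x i₀ = 0 → x = 0)
    (h2 : ∀ x ∈ Sol θ U K₀ K₁, x i₀ ∈ W) (h3 : ∀ v ∈ W, ∃ x ∈ Sol θ U K₀ K₁, x i₀ = v) :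
    Module.finrank ℂ (Sol θ U K₀ K₁) = Module.finrank ℂ W := by
  let f : Sol θ U K₀ K₁ →ₗ[ℂ] W :=
    ((LinearMap.proj i₀).comp (Sol θ U K₀ K₁).subtype).codRestrict _ (fun x => h2 x.1 x.2)
  refine LinearEquiv.finrank_eq (LinearEquiv.ofBijective f ⟨?_, ?_⟩)
  · rw [← LinearMap.ker_eq_bot, eq_bot_iff]
    intro x hx
    have : x.1 i₀ = 0 := congrArg Subtype.val (LinearMap.mem_ker.1 hx)
    exact Subtype.ext (h1 x.1 x.2 this)
  · rintro ⟨v, hv⟩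
    obtain ⟨x, hx, rfl⟩ := h3 v hv
    exact ⟨⟨x, hx⟩, rfl⟩

theorem Sol_J (θ φ : Module.End ℂ V) (U : Submodule ℂ V) {k : ℕ} (hk : 1 ≤ k) (ε : ℂ) (W : Submodule ℂ V)
    (hθ : ∀ v, θ v = ε • v + φ v)
    (hW : ∀ v, v ∈ W ↔ (∀ j < k, (φ ^ j) v ∈ U) ∧ (φ ^ k) v = 0) :
    Module.finrank ℂ (Sol θ U (Jblock k ε) 1) = Module.finrank ℂ W := by
  have hmem : ∀ x : Fin k → V, x ∈ Sol θ U (Jblock k ε) 1 ↔ (∀ i, x i ∈ U) ∧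
      ∀ i : Fin k, (if h : (i : ℕ) + 1 < k then x ⟨i + 1, h⟩ else 0) = φ (x i) := by
    intro x
    rw [mem_Sol, act_one]
    refine and_congr_right fun _ => ?_
    rw [funext_iff]
    refine forall_congr' fun i => ?_
    rw [act_J, hθ]
    exact add_right_inj _
  have hpow : ∀ x ∈ Sol θ U (Jblock k ε) 1, ∀ j (hj : j < k), x ⟨j, hj⟩ = (φ ^ j) (x ⟨0, by omega⟩) := by
    intro x hx j
    induction j with
    | zero => intro hj; simp
    | succ j ih =>
      intro hj
      have h1 := ((hmem x).1 hx).2 ⟨j, by omega⟩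
      rw [dif_pos hj] at h1
      rw [h1, ih (by omega), pow_succ', Module.End.mul_apply]
  refine Sol_finrank_eval θ U _ _ ⟨0, by omega⟩ W ?_ ?_ ?_
  · intro x hx h0
    ext ⟨j, hj⟩
    rw [hpow x hx j hj, h0, map_zero]; rfl
  · intro x hx
    rw [hW]
    refine ⟨fun j hj => by rw [← hpow x hx j hj]; exact hx.1 _, ?_⟩
    have h1 := ((hmem x).1 hx).2 ⟨k - 1, by omega⟩
    rw [dif_neg (by simp; omega), hpow x hx, ← Module.End.mul_apply, ← pow_succ',
      show k - 1 + 1 = k by omega] at h1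
    exact h1.symm
  · intro v hv
    obtain ⟨hv1, hv2⟩ := (hW v).1 hv
    refine ⟨fun j => (φ ^ (j : ℕ)) v, (hmem _).2 ⟨fun j => hv1 j j.2, ?_⟩, by simp⟩
    intro i
    rw [← Module.End.mul_apply, ← pow_succ']
    split_ifs with h
    · rfl
    · rw [show (i : ℕ) + 1 = k by omega, hv2]

theorem Sol_zero (θ : Module.End ℂ V) (U : Submodule ℂ V) {k : ℕ} (hk : 1 ≤ k) (W : Submodule ℂ V)
    (hW : ∀ v, v ∈ W ↔ (∀ j, 2 * j < k → (θ ^ j) v ∈ U) ∧ (k % 2 = 0 → (θ ^ (k / 2)) v = 0)) :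
    Module.finrank ℂ (Sol θ U (Jblock k 0) (Jblock k 0)ᵀ) = Module.finrank ℂ W := by
  have hmem : ∀ x : Fin k → V, x ∈ Sol θ U (Jblock k 0) (Jblock k 0)ᵀ ↔ (∀ i, x i ∈ U) ∧
      ∀ i : Fin k, (if h : (i : ℕ) + 1 < k then x ⟨i + 1, h⟩ else 0) =
        if h : 0 < (i : ℕ) then θ (x ⟨i - 1, by omega⟩) else 0 := by
    intro x
    rw [mem_Sol]
    refine and_congr_right fun _ => ?_
    rw [funext_iff]
    refine forall_congr' fun i => ?_
    rw [act_J, act_JT, zero_smul, zero_add]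
  have hpow : ∀ x ∈ Sol θ U (Jblock k 0) (Jblock k 0)ᵀ, ∀ j (hj : j < k), x ⟨j, hj⟩ =
      if j % 2 = 0 then (θ ^ (j / 2)) (x ⟨0, by omega⟩) else 0 := by
    intro x hx j
    induction j using Nat.strong_induction_on with
    | _ j ih =>
      intro hj
      rcases j with _ | j
      · simp
      · have h1 := ((hmem x).1 hx).2 ⟨j, by omega⟩
        rw [dif_pos hj] at h1
        rw [h1]
        rcases j with _ | j
        · simp
        · rw [dif_pos (by simp)]
          have h2 := ih j (by omega) (by omega)
          simp only [Nat.add_sub_cancel]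
          rw [h2, show (j + 1 + 1) % 2 = j % 2 by omega, show (j + 1 + 1) / 2 = j / 2 + 1 by omega]
          split_ifs
          · rw [pow_succ', Module.End.mul_apply]
          · rw [map_zero]
  refine Sol_finrank_eval θ U _ _ ⟨0, by omega⟩ W ?_ ?_ ?_
  · intro x hx h0
    ext ⟨j, hj⟩
    rw [hpow x hx j hj, h0, map_zero]; simp
  · intro x hx
    rw [hW]
    refine ⟨fun j hj => ?_, fun hk2 => ?_⟩
    · have := hpow x hx (2 * j) hj
      rw [if_pos (by omega), show 2 * j / 2 = j by omega] at this
      rw [← this]; exact hx.1 _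
    · have h1 := ((hmem x).1 hx).2 ⟨k - 1, by omega⟩
      rw [dif_neg (by simp; omega), dif_pos (by simp; omega), hpow x hx, if_pos (by simp; omega),
        ← Module.End.mul_apply, ← pow_succ'] at h1
      simp only at h1
      rw [show (k - 1 - 1) / 2 + 1 = k / 2 by omega] at h1
      exact h1.symm
  · intro v hv
    obtain ⟨hv1, hv2⟩ := (hW v).1 hv
    refine ⟨fun j => if (j : ℕ) % 2 = 0 then (θ ^ ((j : ℕ) / 2)) v else 0, (hmem _).2 ⟨fun j => ?_, ?_⟩,
      by simp⟩
    · split_ifs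
      · exact hv1 _ (by omega)
      · exact U.zero_mem
    · intro i
      have key : ∀ j, ((if j % 2 = 0 then (θ ^ (j / 2 + 1)) v else 0) : V) =
        θ (if j % 2 = 0 then (θ ^ (j / 2)) v else 0) := by
        intro j
        split_ifs
        · rw [pow_succ', Module.End.mul_apply]
        · rw [map_zero]
      by_cases h0 : 0 < (i : ℕ)
      · rw [dif_pos h0, ← key]
        simp only []
        by_cases h : (i : ℕ) + 1 < k
        · rw [dif_pos h, show ((i : ℕ) - 1) % 2 = (i + 1) % 2 by omega,
            show ((i : ℕ) - 1) / 2 + 1 = (i + 1) / 2 by omega]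
        · rw [dif_neg h]
          split_ifs with h2
          · rw [show ((i : ℕ) - 1) / 2 + 1 = k / 2 by omega, hv2 (by omega)]
          · rfl
      · rw [dif_neg h0, show (i : ℕ) = 0 by omega]
        simp

end solspace

end part7

section part8

section seqspace

/-- Sequences supported on `{0, …, m-1}`. -/
def Usub (m : ℕ) : Submodule ℂ (ℕ → ℂ) where
  carrier := {v | ∀ i, m ≤ i → v i = 0}
  add_mem' := by
    intro v w hv hw i hi
    simp [hv i hi, hw i hi]
  zero_mem' := by intro i _; rfl
  smul_mem' := by
    intro c v hv i hi
    simp [hv i hi]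

theorem mem_Usub {m : ℕ} {v : ℕ → ℂ} : v ∈ Usub m ↔ ∀ i, m ≤ i → v i = 0 := Iff.rfl

/-- Truncated sequences are tuples. -/
def UsubEquiv (m : ℕ) : Usub m ≃ₗ[ℂ] (Fin m → ℂ) where
  toFun v := fun i => v.1 i
  map_add' _ _ := rfl
  map_smul' _ _ := rfl
  invFun w := ⟨fun i => if h : i < m then w ⟨i, h⟩ else 0, fun i hi => by
    exact dif_neg (by omega)⟩
  left_inv v := by
    ext i
    simp only
    split_ifs with h
    · rfl
    · exact (v.2 i (by omega)).symm
  right_inv w := by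
    ext i
    simp

instance Usub_fin (m : ℕ) : FiniteDimensional ℂ (Usub m) :=
  Module.Finite.equiv (UsubEquiv m).symm

theorem Usub_finrank (m : ℕ) : Module.finrank ℂ (Usub m) = m := by
  rw [LinearEquiv.finrank_eq (UsubEquiv m)]; simp

/-- `lam + left shift`. -/
def shL (lam : ℂ) : Module.End ℂ (ℕ → ℂ) where
  toFun v := fun n => lam * v n + v (n + 1)
  map_add' v w := by ext n; simp; ring
  map_smul' c v := by ext n; simp; ring

/-- `right shift - lam`. -/
def shR (lam : ℂ) : Module.End ℂ (ℕ → ℂ) where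
  toFun v := fun n => (if n = 0 then 0 else v (n - 1)) - lam * v n
  map_add' v w := by
    ext n
    by_cases h : n = 0 <;> simp [h] <;> ring
  map_smul' c v := by
    ext n
    by_cases h : n = 0 <;> simp [h] <;> ring

theorem shL_apply (lam : ℂ) (v : ℕ → ℂ) (n : ℕ) : shL lam v n = lam * v n + v (n + 1) := rfl

theorem shR_apply (lam : ℂ) (v : ℕ → ℂ) (n : ℕ) :
    shR lam v n = (if n = 0 then 0 else v (n - 1)) - lam * v n := rfl

theorem shL_pow (j : ℕ) (v : ℕ → ℂ) (n : ℕ) : (shL 0 ^ j) v n = v (n + j) := by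
  induction j generalizing n with
  | zero => simp
  | succ j ih =>
    rw [pow_succ', Module.End.mul_apply, shL_apply, ih, ih, zero_mul, zero_add]
    congr 1; omega

theorem shR_pow (j : ℕ) (v : ℕ → ℂ) (n : ℕ) :
    (shR 0 ^ j) v n = if j ≤ n then v (n - j) else 0 := by
  induction j generalizing n with
  | zero => simp
  | succ j ih =>
    rw [pow_succ', Module.End.mul_apply, shR_apply, ih, ih, zero_mul, sub_zero]
    by_cases h : n = 0
    · simp [h]
    · rw [if_neg h]
      by_cases h2 : j ≤ n - 1
      · rw [if_pos h2, if_pos (by omega)]; congr 1; omega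
      · rw [if_neg h2, if_neg (by omega)]

theorem shL_mem (lam : ℂ) (m : ℕ) : ∀ v ∈ Usub m, shL lam v ∈ Usub m := by
  intro v hv i hi
  rw [shL_apply, hv i hi, hv (i + 1) (by omega)]; simp

theorem pow_mem_of {φ : Module.End ℂ (ℕ → ℂ)} {U : Submodule ℂ (ℕ → ℂ)} (hU : ∀ v ∈ U, φ v ∈ U) (j : ℕ) :
    ∀ v ∈ U, (φ ^ j) v ∈ U := by
  induction j with
  | zero => intro v hv; simpa using hv
  | succ j ih =>
    intro v hv
    rw [pow_succ', Module.End.mul_apply]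
    exact hU _ (ih v hv)

theorem pow_inj_of {φ : Module.End ℂ (ℕ → ℂ)} {U : Submodule ℂ (ℕ → ℂ)} (hU : ∀ v ∈ U, φ v ∈ U)
    (hi : ∀ v ∈ U, φ v = 0 → v = 0) (j : ℕ) : ∀ v ∈ U, (φ ^ j) v = 0 → v = 0 := by
  induction j with
  | zero => intro v _ h; simpa using h
  | succ j ih =>
    intro v hv h
    rw [pow_succ', Module.End.mul_apply] at h
    exact ih v hv (hi _ (pow_mem_of hU j v hv) h)

theorem shL_inj {lam : ℂ} (hl : lam ≠ 0) (m : ℕ) : ∀ v ∈ Usub m, shL lam v = 0 → v = 0 := by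
  intro v hv h
  have key : ∀ j i, m ≤ i + j → v i = 0 := by
    intro j
    induction j with
    | zero => intro i hi; exact hv i hi
    | succ j ih =>
      intro i hi
      have h1 := congrFun h i
      rw [shL_apply, ih (i + 1) (by omega), add_zero] at h1
      simpa [hl] using h1
  ext i
  exact key m i (by omega)

theorem shR_inj (lam : ℂ) : ∀ v : ℕ → ℂ, shR lam v = 0 → v = 0 := by
  intro v h
  by_cases hl : lam = 0
  · subst hl
    ext i
    have := congrFun h (i + 1)
    rw [shR_apply] at this
    simpa using this
  · have key : ∀ i, v i = 0 := by
      intro i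
      induction i with
      | zero =>
        have := congrFun h 0
        rw [shR_apply] at this
        simpa [hl] using this
      | succ i ih =>
        have := congrFun h (i + 1)
        rw [shR_apply] at this
        simpa [hl, ih] using this
    ext i; exact key i

theorem Sol_shL_J (lam ε : ℂ) (m : ℕ) {k : ℕ} (hk : 1 ≤ k) :
    Module.finrank ℂ (Sol (shL lam) (Usub m) (Jblock k ε) 1) = if lam = ε then min m k else 0 := by
  split_ifs with h
  · subst h
    rw [Sol_J (shL lam) (shL 0) (Usub m) hk lam (Usub (min m k)), Usub_finrank]
    · intro v; ext n; simp [shL_apply]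
    · intro v
      constructor
      · intro hv
        refine ⟨fun j _ i hi => ?_, ?_⟩
        · rw [shL_pow]; exact hv _ (by omega)
        · ext i; rw [shL_pow]; exact hv _ (by omega)
      · rintro ⟨h1, h2⟩ i hi
        by_cases hm : m ≤ i
        · have := h1 0 (by omega) i hm
          simpa using this
        · have := congrFun h2 (i - k)
          rw [shL_pow, show i - k + k = i by omega] at this
          exact this
  · have hl : lam - ε ≠ 0 := sub_ne_zero.2 h
    rw [Sol_J (shL lam) (shL (lam - ε)) (Usub m) hk ε ⊥, finrank_bot]
    · intro v; ext n; simp [shL_apply]; ring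
    · intro v
      rw [Submodule.mem_bot]
      constructor
      · rintro rfl
        simp
      · rintro ⟨h1, h2⟩
        exact pow_inj_of (shL_mem _ m) (shL_inj hl m) k v (by simpa using h1 0 (by omega)) h2

theorem Sol_shL_zero (lam : ℂ) (m : ℕ) {k : ℕ} (hk : 1 ≤ k) :
    Module.finrank ℂ (Sol (shL lam) (Usub m) (Jblock k 0) (Jblock k 0)ᵀ) =
      if k % 2 = 1 then m else if lam = 0 then min m (k / 2) else 0 := by
  split_ifs with h h'
  · rw [Sol_zero (shL lam) (Usub m) hk (Usub m), Usub_finrank]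
    intro v
    constructor
    · intro hv
      exact ⟨fun j _ => pow_mem_of (shL_mem _ m) j v hv, fun h => by omega⟩
    · rintro ⟨h1, -⟩
      simpa using h1 0 (by omega)
  · subst h'
    rw [Sol_zero (shL 0) (Usub m) hk (Usub (min m (k / 2))), Usub_finrank]
    intro v
    constructor
    · intro hv
      refine ⟨fun j _ i hi => ?_, fun _ => ?_⟩
      · rw [shL_pow]; exact hv _ (by omega)
      · ext i; rw [shL_pow]; exact hv _ (by omega)
    · rintro ⟨h1, h2⟩ i hi
      by_cases hm : m ≤ i
      · have := h1 0 (by omega) i hm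
        simpa using this
      · have := congrFun (h2 (by omega)) (i - k / 2)
        rw [shL_pow, show i - k / 2 + k / 2 = i by omega] at this
        exact this
  · rw [Sol_zero (shL lam) (Usub m) hk ⊥, finrank_bot]
    intro v
    rw [Submodule.mem_bot]
    constructor
    · rintro rfl
      simp
    · rintro ⟨h1, h2⟩
      exact pow_inj_of (shL_mem _ m) (shL_inj h' m) (k / 2) v (by simpa using h1 0 (by omega))
        (h2 (by omega))

theorem Sol_shR_J (ε : ℂ) (m : ℕ) {k : ℕ} (hk : 1 ≤ k) :
    Module.finrank ℂ (Sol (shR 0) (Usub m) (Jblock k ε) 1) = 0 := by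
  rw [Sol_J (shR 0) (shR ε) (Usub m) hk ε ⊥, finrank_bot]
  · intro v; ext n; simp [shR_apply]
  · intro v
    rw [Submodule.mem_bot]
    constructor
    · rintro rfl
      simp
    · rintro ⟨h1, h2⟩
      exact pow_inj_of (U := ⊤) (fun _ _ => trivial) (fun v _ => shR_inj ε v) k v trivial h2

theorem Sol_shR_zero (m : ℕ) {k : ℕ} (hk : 1 ≤ k) :
    Module.finrank ℂ (Sol (shR 0) (Usub m) (Jblock k 0) (Jblock k 0)ᵀ) =
      if k % 2 = 1 then m - k / 2 else 0 := by
  split_ifs with h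
  · rw [Sol_zero (shR 0) (Usub m) hk (Usub (m - k / 2)), Usub_finrank]
    intro v
    constructor
    · intro hv
      refine ⟨fun j hj i hi => ?_, fun h => by omega⟩
      rw [shR_pow]
      split_ifs
      · exact hv _ (by omega)
      · rfl
    · rintro ⟨h1, -⟩ i hi
      have := h1 (k / 2) (by omega) (i + k / 2) (by omega)
      rw [shR_pow, if_pos (by omega)] at this
      simpa using this
  · rw [Sol_zero (shR 0) (Usub m) hk ⊥, finrank_bot]
    intro v
    rw [Submodule.mem_bot]
    constructor
    · rintro rfl
      simp
    · rintro ⟨h1, h2⟩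
      exact pow_inj_of (U := ⊤) (fun _ _ => trivial) (fun v _ => shR_inj 0 v) (k / 2) v trivial
        (h2 (by omega))

end seqspace

/-- Invariants of a block, first kind. -/
def dL (m : ℕ) (lam : ℂ) : CBlock → ℕ
  | .type0 k => if k % 2 = 1 then m else if lam = 0 then min m (k / 2) else 0
  | .typeI k => if lam = (-1) ^ (k + 1) then min m k else 0
  | .typeII k μ => (if lam = μ then min m k else 0) + (if lam = μ⁻¹ then min m k else 0)

/-- Invariants of a block, second kind. -/
def dR (m : ℕ) : CBlock → ℕ
  | .type0 k => if k % 2 = 1 then m - k / 2 else 0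
  | .typeI _ => 0
  | .typeII _ _ => 0

theorem dL_eq (m : ℕ) (lam : ℂ) (b : CBlock) (hb : b.Valid) :
    Module.finrank ℂ (Sol (shL lam) (Usub m) b.mat b.matᵀ) = dL m lam b := by
  cases b with
  | type0 k => exact Sol_shL_zero lam m hb
  | typeI k =>
    refine (Sol_eq _ _ (se_Gamma hb)).trans ?_
    exact Sol_shL_J lam _ m hb
  | typeII k μ =>
    obtain ⟨hk, hμ, -⟩ := hb
    refine (Sol_eq _ _ ((cong_reindex finSumFinEquiv (fromBlocks 0 1 (Jblock k μ) 0)).se.symm'.trans'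
      (se_H hk hμ))).trans ?_
    rw [← fromBlocks_one, Sol_blocks, Sol_shL_J _ _ _ hk, Sol_shL_J _ _ _ hk]
    rfl

theorem dR_eq (m : ℕ) (b : CBlock) (hb : b.Valid) :
    Module.finrank ℂ (Sol (shR 0) (Usub m) b.mat b.matᵀ) = dR m b := by
  cases b with
  | type0 k => exact Sol_shR_zero m hb
  | typeI k =>
    refine (Sol_eq _ _ (se_Gamma hb)).trans ?_
    exact Sol_shR_J _ m hb
  | typeII k μ =>
    obtain ⟨hk, hμ, -⟩ := hb
    refine (Sol_eq _ _ ((cong_reindex finSumFinEquiv (fromBlocks 0 1 (Jblock k μ) 0)).se.symm'.trans'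
      (se_H hk hμ))).trans ?_
    rw [← fromBlocks_one, Sol_blocks, Sol_shR_J _ _ hk, Sol_shR_J _ _ hk]
    rfl

theorem Sol_list (θ : Module.End ℂ (ℕ → ℂ)) (m : ℕ) (d : CBlock → ℕ)
    (hd : ∀ b : CBlock, b.Valid → Module.finrank ℂ (Sol θ (Usub m) b.mat b.matᵀ) = d b)
    (L : List CBlock) (hL : ∀ b ∈ L, b.Valid) :
    Module.finrank ℂ (Sol θ (Usub m) (blocksMat L) (blocksMat L)ᵀ) = (L.map d).sum := by
  induction L with
  | nil =>
    simp only [List.map_nil, List.sum_nil]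
    have : Subsingleton (Fin (blocksSize []) → (ℕ → ℂ)) :=
      ⟨fun x y => funext fun i => Fin.elim0 i⟩
    exact Module.finrank_zero_of_subsingleton
  | cons b L ih =>
    rw [List.map_cons, List.sum_cons, ← hd b (hL b (by simp)), ← ih (fun c hc => hL c (by simp [hc]))]
    refine (Sol_eq _ _
      (cong_reindex finSumFinEquiv (fromBlocks b.mat 0 0 (blocksMat L))).se.symm').trans ?_
    rw [fromBlocks_transpose, transpose_zero, transpose_zero, Sol_blocks]

theorem sums_eq {L₁ L₂ : List CBlock} (h1 : ∀ b ∈ L₁, b.Valid) (h2 : ∀ b ∈ L₂, b.Valid)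
    (h : Cong (blocksMat L₁) (blocksMat L₂)) :
    (∀ m lam, (L₁.map (dL m lam)).sum = (L₂.map (dL m lam)).sum) ∧
    (∀ m, (L₁.map (dR m)).sum = (L₂.map (dR m)).sum) := by
  constructor
  · intro m lam
    rw [← Sol_list (shL lam) m _ (dL_eq m lam) L₁ h1, ← Sol_list (shL lam) m _ (dL_eq m lam) L₂ h2]
    exact Sol_eq _ _ h.se
  · intro m
    rw [← Sol_list (shR 0) m _ (dR_eq m) L₁ h1, ← Sol_list (shR 0) m _ (dR_eq m) L₂ h2]
    exact Sol_eq _ _ h.se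

end part8

section part9

/-- Multiplicity weights of the canonical blocks, indexed by keys. -/
def wt : (ℕ × ℂ) ⊕ ℕ → CBlock → ℤ
  | .inl (s, lam), .type0 k => if k = 2 * s ∧ lam = 0 then 1 else 0
  | .inl (s, lam), .typeI k => if k = s ∧ lam = (-1) ^ (k + 1) then 1 else 0
  | .inl (s, lam), .typeII k μ =>
      if k = s then (if lam = μ then 1 else 0) + (if lam = μ⁻¹ then 1 else 0) else 0
  | .inr r, .type0 k => if k = 2 * r + 1 then 1 else 0
  | .inr _, .typeI _ => 0
  | .inr _, .typeII _ _ => 0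

theorem wt_nonneg (q : (ℕ × ℂ) ⊕ ℕ) (b : CBlock) : 0 ≤ wt q b := by
  rcases q with ⟨s, lam⟩ | r <;> cases b <;> simp only [wt] <;> (try split_ifs) <;> norm_num

theorem min_second (s k : ℕ) (hs : 1 ≤ s) :
    2 * ((min s k : ℕ) : ℤ) - ((min (s - 1) k : ℕ) : ℤ) - ((min (s + 1) k : ℕ) : ℤ) =
      if k = s then 1 else 0 := by
  split_ifs <;> omega

theorem wt_L (s : ℕ) (hs : 1 ≤ s) (lam : ℂ) (b : CBlock) :
    wt (.inl (s, lam)) b = 2 * (dL s lam b : ℤ) - dL (s - 1) lam b - dL (s + 1) lam b := by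
  cases b with
  | type0 k =>
    simp only [wt, dL]
    by_cases h1 : k % 2 = 1
    · rw [if_neg (by rintro ⟨h, -⟩; omega)]
      simp only [h1, if_true]; omega
    · by_cases h2 : lam = 0
      · simp only [h1, h2, if_true, if_false, and_true]
        rw [min_second s (k / 2) hs]
        split_ifs <;> first | rfl | omega
      · simp [h1, h2]
  | typeI k =>
    simp only [wt, dL]
    by_cases h2 : lam = (-1) ^ (k + 1)
    · simp only [← h2, if_true, and_true]
      rw [min_second s k hs]
    · simp [h2]
  | typeII k μ =>
    simp only [wt, dL]
    have := min_second s k hs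
    split_ifs at this ⊢ <;> push_cast <;> push_cast at this <;> linarith

theorem wt_R (r : ℕ) (b : CBlock) :
    wt (.inr r) b = (dR (r + 1) b : ℤ) - 2 * dR r b + dR (r - 1) b := by
  cases b with
  | type0 k =>
    simp only [wt, dR]
    split_ifs <;> omega
  | typeI k => simp [wt, dR]
  | typeII k μ => simp [wt, dR]

theorem sum_lin (L : List CBlock) (f g h : CBlock → ℕ) (a b c : ℤ) :
    (L.map fun x => a * (f x : ℤ) + b * (g x : ℤ) + c * (h x : ℤ)).sum =
      a * ((L.map f).sum : ℕ) + b * ((L.map g).sum : ℕ) + c * ((L.map h).sum : ℕ) := by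
  induction L with
  | nil => simp
  | cons x L ih =>
    simp only [List.map_cons, List.sum_cons, ih]
    push_cast
    ring

/-- Admissible keys. -/
def keyOK : (ℕ × ℂ) ⊕ ℕ → Prop
  | .inl (s, _) => 1 ≤ s
  | .inr _ => True

theorem wt_sums {L₁ L₂ : List CBlock}
    (hL : ∀ m lam, (L₁.map (dL m lam)).sum = (L₂.map (dL m lam)).sum)
    (hR : ∀ m, (L₁.map (dR m)).sum = (L₂.map (dR m)).sum) (q : (ℕ × ℂ) ⊕ ℕ) (hq : keyOK q) :
    (L₁.map (wt q)).sum = (L₂.map (wt q)).sum := by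
  rcases q with ⟨s, lam⟩ | r
  · have h : wt (.inl (s, lam)) = fun x => (2 : ℤ) * (dL s lam x : ℤ) + (-1) * (dL (s - 1) lam x : ℤ) +
        (-1) * (dL (s + 1) lam x : ℤ) := by
      funext x
      rw [wt_L s hq]; ring
    rw [h, sum_lin, sum_lin, hL, hL, hL]
  · have h : wt (.inr r) = fun x => (1 : ℤ) * (dR (r + 1) x : ℤ) + (-2) * (dR r x : ℤ) +
        1 * (dR (r - 1) x : ℤ) := by
      funext x
      rw [wt_R]; ring
    rw [h, sum_lin, sum_lin, hR, hR, hR]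

theorem wt_equiv {b b' : CBlock} (h : b.Equiv b') (q : (ℕ × ℂ) ⊕ ℕ) : wt q b = wt q b' := by
  rcases h with rfl | ⟨k, μ, rfl, rfl⟩
  · rfl
  · rcases q with ⟨s, lam⟩ | r
    · simp only [wt, inv_inv]
      rw [add_comm]
    · rfl

theorem pm_inv (k : ℕ) {μ : ℂ} (h : (-1 : ℂ) ^ k = μ⁻¹) : μ = (-1) ^ k := by
  rw [← inv_inv μ, ← h]
  rcases neg_one_pow_eq_or ℂ k with h | h <;> rw [h] <;> norm_num

theorem wt_key (b : CBlock) (hb : b.Valid) : ∃ q, keyOK q ∧ 0 < wt q b ∧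
    ∀ b' : CBlock, b'.Valid → 0 < wt q b' → b.Equiv b' := by
  cases b with
  | type0 k =>
    have hk : 1 ≤ k := hb
    rcases Nat.even_or_odd' k with ⟨s, rfl | rfl⟩
    · refine ⟨.inl (s, 0), show 1 ≤ s by omega, by simp [wt], ?_⟩
      intro b' hb' hw
      cases b' with
      | type0 k' =>
        simp only [wt] at hw
        split_ifs at hw with h
        · left; rw [h.1]
        · omega
      | typeI k' =>
        simp only [wt] at hw
        split_ifs at hw with h
        · exact absurd h.2.symm (pow_ne_zero _ (by norm_num))
        · omega
      | typeII k' μ =>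
        have h1 : (0 : ℂ) ≠ μ := fun h => hb'.2.1 h.symm
        have h2 : (0 : ℂ) ≠ μ⁻¹ := fun h => inv_ne_zero hb'.2.1 h.symm
        simp [wt, h1, h2] at hw
    · refine ⟨.inr s, trivial, by simp [wt], ?_⟩
      intro b' hb' hw
      cases b' with
      | type0 k' =>
        simp only [wt] at hw
        split_ifs at hw with h
        · left; rw [h]
        · omega
      | typeI k' => simp [wt] at hw
      | typeII k' μ => simp [wt] at hw
  | typeI k =>
    refine ⟨.inl (k, (-1) ^ (k + 1)), hb, by simp [wt], ?_⟩
    intro b' hb' hw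
    cases b' with
    | type0 k' =>
      simp only [wt] at hw
      split_ifs at hw with h
      · exact absurd h.2 (pow_ne_zero _ (by norm_num))
      · omega
    | typeI k' =>
      simp only [wt] at hw
      split_ifs at hw with h
      · left; rw [h.1]
      · omega
    | typeII k' μ =>
      obtain ⟨-, -, h3⟩ := hb'
      simp only [wt] at hw
      by_cases hk : k' = k
      · subst hk
        have h4 : ¬ ((-1 : ℂ) ^ (k' + 1) = μ) := fun h => h3 h.symm
        have h5 : ¬ ((-1 : ℂ) ^ (k' + 1) = μ⁻¹) := fun h => h3 (pm_inv _ h)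
        rw [if_pos rfl, if_neg h4, if_neg h5] at hw
        omega
      · rw [if_neg hk] at hw; omega
  | typeII k μ =>
    obtain ⟨h1, h2, h3⟩ := hb
    refine ⟨.inl (k, μ), h1, ?_, ?_⟩
    · simp only [wt, if_true]
      split_ifs <;> norm_num
    intro b' hb' hw
    cases b' with
    | type0 k' =>
      simp only [wt] at hw
      split_ifs at hw with h
      · exact absurd h.2 h2
      · omega
    | typeI k' =>
      simp only [wt] at hw
      split_ifs at hw with h
      · obtain ⟨rfl, h'⟩ := h
        exact absurd h' h3
      · omega
    | typeII k' μ' =>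
      simp only [wt] at hw
      by_cases hk : k' = k
      · subst hk
        by_cases h4 : μ = μ'
        · left; rw [h4]
        · by_cases h5 : μ = μ'⁻¹
          · right
            exact ⟨k', μ, rfl, by rw [h5, inv_inv]⟩
          · simp [h4, h5] at hw
      · rw [if_neg hk] at hw; omega

theorem sum_wt_nonneg (q : (ℕ × ℂ) ⊕ ℕ) (L : List CBlock) : 0 ≤ (L.map (wt q)).sum := by
  apply List.sum_nonneg
  intro x hx
  obtain ⟨b, -, rfl⟩ := List.mem_map.1 hx
  exact wt_nonneg q b

theorem exists_pos_of_sum (q : (ℕ × ℂ) ⊕ ℕ) (L : List CBlock) (h : 0 < (L.map (wt q)).sum) :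
    ∃ b ∈ L, 0 < wt q b := by
  by_contra hc
  push Not at hc
  have : (L.map (wt q)).sum ≤ 0 := by
    induction L with
    | nil => simp
    | cons a L ih =>
      rw [List.map_cons, List.sum_cons]
      have h1 := hc a (by simp)
      by_cases hp : 0 < (L.map (wt q)).sum
      · have := ih hp (fun b hb => hc b (by simp [hb])); omega
      · omega
  omega

theorem rel_of_sums (L₁ L₂ : List CBlock) (h1 : ∀ b ∈ L₁, b.Valid) (h2 : ∀ b ∈ L₂, b.Valid)
    (h : ∀ q, keyOK q → (L₁.map (wt q)).sum = (L₂.map (wt q)).sum) :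
    Multiset.Rel CBlock.Equiv (↑L₁) (↑L₂) := by
  induction L₁ generalizing L₂ with
  | nil =>
    cases L₂ with
    | nil => exact Multiset.Rel.zero
    | cons b L =>
      exfalso
      obtain ⟨q, hq, hp, -⟩ := wt_key b (h2 b (by simp))
      have := h q hq
      have h3 := sum_wt_nonneg q L
      simp only [List.map_nil, List.sum_nil, List.map_cons, List.sum_cons] at this
      omega
  | cons b L ih =>
    obtain ⟨q, hq, hp, he⟩ := wt_key b (h1 b (by simp))
    have h3 := sum_wt_nonneg q L
    have h4 := h q hq
    rw [List.map_cons, List.sum_cons] at h4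
    obtain ⟨b', hb', hp'⟩ := exists_pos_of_sum q L₂ (by omega)
    have hE := he b' (h2 b' hb') hp'
    obtain ⟨l, r, rfl⟩ := List.append_of_mem hb'
    have hperm : ((l ++ b' :: r : List CBlock) : Multiset CBlock) = b' ::ₘ ((l ++ r : List CBlock) : Multiset CBlock) := by
      rw [Multiset.cons_coe, Multiset.coe_eq_coe]
      exact List.perm_middle
    rw [hperm, ← Multiset.cons_coe]
    refine Multiset.Rel.cons hE (ih (l ++ r) (fun c hc => h1 c (by simp [hc])) ?_ ?_)
    · intro c hc
      refine h2 c ?_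
      simp only [List.mem_append, List.mem_cons] at hc ⊢
      tauto
    · intro q' hq'
      have h5 := h q' hq'
      simp only [List.map_cons, List.sum_cons, List.map_append, List.sum_append] at h5 ⊢
      rw [wt_equiv hE] at h5
      linarith

end part9

/-- **Canonical form for congruence** (Horn–Sergeichuk).  Every complex square matrix is
congruent to a direct sum of canonical blocks of Types 0, I and II, and this direct sum
is uniquely determined up to permutation of the summands and up to replacing the
parameter `μ` of any Type II block `H_{2k}(μ)` by `μ⁻¹`. -/
theorem cfc_existence_and_uniqueness (n : ℕ) (A : Matrix (Fin n) (Fin n) ℂ) :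
    (∃ (L : List CBlock) (h : blocksSize L = n),
      (∀ b ∈ L, b.Valid) ∧
      ∃ P : Matrix (Fin n) (Fin n) ℂ, IsUnit P ∧
        A = P * Matrix.reindex (finCongr h) (finCongr h) (blocksMat L) * Pᵀ) ∧
    ∀ (L₁ L₂ : List CBlock) (h₁ : blocksSize L₁ = n) (h₂ : blocksSize L₂ = n),
      (∀ b ∈ L₁, b.Valid) → (∀ b ∈ L₂, b.Valid) →
      (∃ P : Matrix (Fin n) (Fin n) ℂ, IsUnit P ∧
        A = P * Matrix.reindex (finCongr h₁) (finCongr h₁) (blocksMat L₁) * Pᵀ) →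
      (∃ P : Matrix (Fin n) (Fin n) ℂ, IsUnit P ∧
        A = P * Matrix.reindex (finCongr h₂) (finCongr h₂) (blocksMat L₂) * Pᵀ) →
      Multiset.Rel CBlock.Equiv (↑L₁) (↑L₂) := by
  refine ⟨existence_part n A, ?_⟩
  intro L₁ L₂ h₁ h₂ v₁ v₂ c₁ c₂
  have hc : Cong (blocksMat L₁) (blocksMat L₂) :=
    (cong_of_part A L₁ h₁ c₁).symm'.trans' (cong_of_part A L₂ h₂ c₂)
  obtain ⟨hL, hR⟩ := sums_eq v₁ v₂ hc
  exact rel_of_sums L₁ L₂ v₁ v₂ (wt_sums hL hR)
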